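/- For every real number a ≥ 1, every zero of φ_K(a,·) away from the points 0, 1, 2 is simple: if ρ ∈ ℂ, ρ ∉ {0, 1, 2}, and φ_K(a,ρ) = 0, then the derivative in s of φ_K(a,s) at s = ρ is nonzero. -/

import Mathlib

open Complex Filter NumberField

/-- The Dedekind zeta function of a number field `K`, given (for `Re(s) > 1`) as the
sum of `N(I)^{-s}` over the nonzero ideals `I` of the ring of integers of `K`. -/
noncomputable def dedekindZetaSum (K : Type*) [Field K] [NumberField K] (s : ℂ) : ℂ :=
  ∑' I : {I : Ideal (𝓞 K) // I ≠ ⊥}, (Ideal.absNorm I.1 : ℂ) ^ (-s)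

/-- `ΛK` is the completed Dedekind zeta function of `K`:
`Λ_K(s) = (√|d_K|/(2π))^s Γ(s) ζ_K(s)` for `Re(s) > 1`, holomorphic away from
(simple) poles at `s = 0` and `s = 1`, and satisfying `Λ_K(s) = Λ_K(1-s)`. -/
structure IsCompletedDedekindZeta (K : Type*) [Field K] [NumberField K]
    (ΛK : ℂ → ℂ) : Prop where
  eq_on_gt_one : ∀ s : ℂ, 1 < s.re → ΛK s =
    ((Real.sqrt |(NumberField.discr K : ℝ)| / (2 * Real.pi) : ℝ) : ℂ) ^ s *
      Complex.Gamma s * dedekindZetaSum K s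
  differentiableOn : DifferentiableOn ℂ ΛK {(0 : ℂ), 1}ᶜ
  functional_equation : ∀ s : ℂ, ΛK s = ΛK (1 - s)
  simple_pole_at_one : ∃ r : ℂ, r ≠ 0 ∧
    Tendsto (fun s : ℂ => (s - 1) * ΛK s) (nhdsWithin 1 {(1 : ℂ)}ᶜ) (nhds r)

/-- The constant term `φ_K(a,s) = a^s Λ_K(s) + a^{2-s} Λ_K(s-1)` of the Eisenstein
series attached to `PSL(2, 𝓞_K)`. -/
noncomputable def phiK (ΛK : ℂ → ℂ) (a : ℝ) (s : ℂ) : ℂ :=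
  (a : ℂ) ^ s * ΛK s + (a : ℂ) ^ (2 - s) * ΛK (s - 1)

open scoped Topology

section Euler

variable {M : Type*} [CommMonoidWithZero M]

/-- Sieving out finitely many pairwise non-associated primes from a completely multiplicative
sum. -/
theorem hasSum_indicator_not_dvd [IsCancelMulZero M] (f : M →*₀ ℂ) {Z : ℂ} (hZ : HasSum f Z) (S : Finset M)
    (hS : ∀ P ∈ S, Prime P) (hassoc : ∀ P ∈ S, ∀ Q ∈ S, P ∣ Q → P = Q) :
    HasSum (Set.indicator {I | ∀ P ∈ S, ¬ P ∣ I} f) ((∏ P ∈ S, (1 - f P)) * Z) := by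
  classical
  induction S using Finset.induction_on with
  | empty => simpa using hZ
  | insert P S hPS ih =>
    have hP := hS P (Finset.mem_insert_self _ _)
    have ih' := ih (fun Q hQ => hS Q (Finset.mem_insert_of_mem hQ))
      (fun Q hQ R hR => hassoc Q (Finset.mem_insert_of_mem hQ) R (Finset.mem_insert_of_mem hR))
    have hinj : Function.Injective (fun J : M => P * J) := mul_right_injective₀ hP.ne_zero
    have h1 : HasSum (Set.indicator {I | P ∣ I} (Set.indicator {I | ∀ Q ∈ S, ¬ Q ∣ I} f))
        (f P * ((∏ Q ∈ S, (1 - f Q)) * Z)) := by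
      rw [← hinj.hasSum_iff]
      · convert! ih'.mul_left (f P) using 1
        funext J
        have hiff : (∀ Q ∈ S, ¬ Q ∣ P * J) ↔ (∀ Q ∈ S, ¬ Q ∣ J) := by
          refine forall₂_congr fun Q hQ => not_congr ⟨fun h => ?_, fun h => h.mul_left _⟩
          rcases (hS Q (Finset.mem_insert_of_mem hQ)).dvd_or_dvd h with h | h
          · exact absurd (hassoc Q (Finset.mem_insert_of_mem hQ) P
              (Finset.mem_insert_self _ _) h ▸ hQ) hPS
          · exact h
        simp only [Function.comp_apply, Set.indicator_apply, Set.mem_ofPred_eq, dvd_mul_right,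
          if_true, hiff, map_mul, mul_ite, mul_zero]
      · intro I hI
        refine Set.indicator_of_notMem (fun h => hI ?_) _
        obtain ⟨J, rfl⟩ := h
        exact ⟨J, rfl⟩
    convert! ih'.sub h1 using 1
    · funext I
      simp only [Set.indicator_apply, Set.mem_ofPred_eq, Finset.mem_insert, forall_eq_or_imp]
      by_cases h : P ∣ I <;> by_cases h' : ∀ Q ∈ S, ¬ Q ∣ I <;> simp [h, h']
    · rw [Finset.prod_insert hPS]; ring

/-- The Euler product over the primes of a unique factorization monoid with trivial units. -/
theorem tendsto_prod_one_sub_mul [UniqueFactorizationMonoid M] [Subsingleton Mˣ]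
    (f : M →*₀ ℂ) (hf : Summable fun I => ‖f I‖) :
    Tendsto (fun S : Finset {P : M // Prime P} => (∏ P ∈ S, (1 - f P)) * ∑' I, f I) atTop
      (𝓝 1) := by
  classical
  have key (S : Finset {P : M // Prime P}) :
      ∑' I, Set.indicator {I | ∀ P ∈ S, ¬ P.1 ∣ I} f I = (∏ P ∈ S, (1 - f P)) * ∑' I, f I := by
    have := (hasSum_indicator_not_dvd f hf.of_norm.hasSum (S.map (Function.Embedding.subtype _))
      (by simp +contextual) (by
        simp only [Finset.mem_map, Function.Embedding.subtype_apply]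
        rintro _ ⟨P, -, rfl⟩ _ ⟨Q, -, rfl⟩ h
        exact (associated_iff_eq.mp (P.2.associated_of_dvd Q.2 h)))).tsum_eq
    rw [Finset.prod_map] at this
    simpa using this
  have hone : ∑' I, Set.indicator {(1 : M)} f I = 1 := by
    rw [tsum_eq_single 1 (fun I hI => Set.indicator_of_notMem (by simpa using hI) _)]
    simp
  simp_rw [← key]
  rw [← hone]
  refine tendsto_tsum_of_dominated_convergence hf (fun I => ?_)
    (Eventually.of_forall fun S I => norm_indicator_le_norm_self _ _)
  refine tendsto_const_nhds.congr' ?_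
  by_cases h1 : I = 1
  · subst h1
    refine Eventually.of_forall fun S => ?_
    have hmem : (1 : M) ∈ {I | ∀ P ∈ S, ¬ P.1 ∣ I} :=
      fun P _ h => P.2.not_isUnit (isUnit_of_dvd_one h)
    simp only [Set.indicator_of_mem hmem, Set.indicator_of_mem (Set.mem_singleton (1 : M))]
  · rw [Set.indicator_of_notMem (by simpa using h1)]
    by_cases h0 : I = 0
    · simp [h0, Set.indicator_apply]
    obtain ⟨P, hP, hPI⟩ := WfDvdMonoid.exists_irreducible_factor
      (fun h => h1 (isUnit_iff_eq_one.mp h)) h0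
    have hP' := UniqueFactorizationMonoid.irreducible_iff_prime.mp hP
    filter_upwards [eventually_ge_atTop {⟨P, hP'⟩}] with S hS
    rw [Set.indicator_of_notMem]
    exact fun h => h ⟨P, hP'⟩ (by simpa using hS) hPI

theorem norm_apply_lt_one_of_prime [IsCancelMulZero M] (f : M →*₀ ℂ) (hf : Summable fun I => ‖f I‖) {P : M}
    (hP : Prime P) : ‖f P‖ < 1 := by
  have hinj : Function.Injective (fun n : ℕ => P ^ n) :=
    (pow_injective_of_not_isUnit hP.not_isUnit hP.ne_zero)
  have := hf.comp_injective hinj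
  simpa [Function.comp_def, map_pow, summable_geometric_iff_norm_lt_one] using this

/-- `f` and `g` have the same absolute values, so `|∑ f|⁻¹ ≤ ∑ |f|`. -/
theorem one_le_norm_tsum_mul_norm_tsum [UniqueFactorizationMonoid M] [Subsingleton Mˣ]
    (f g : M →*₀ ℂ) (hf : Summable fun I => ‖f I‖) (hg : Summable fun I => ‖g I‖)
    (hfg : ∀ I, g I = (‖f I‖ : ℂ)) : 1 ≤ ‖∑' I, f I‖ * ‖∑' I, g I‖ := by
  have h := ((tendsto_prod_one_sub_mul f hf).mul (tendsto_prod_one_sub_mul g hg)).norm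
  simp only [mul_one, norm_one] at h
  refine le_of_tendsto h (Eventually.of_forall fun S => ?_)
  have : ‖(∏ P ∈ S, (1 - f P)) * ∏ P ∈ S, (1 - g P)‖ ≤ 1 := by
    rw [← Finset.prod_mul_distrib, norm_prod]
    refine Finset.prod_le_one (fun _ _ => norm_nonneg _) fun P _ => ?_
    have h1 := norm_apply_lt_one_of_prime f hf P.2
    rw [hfg, norm_mul, ← ofReal_one, ← ofReal_sub, norm_real, Real.norm_of_nonneg (by linarith)]
    have := norm_sub_le (1 : ℂ) (f P)
    simp only [norm_one, ofReal_one] at *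
    nlinarith [norm_nonneg (f P.1)]
  calc _ = ‖(∏ P ∈ S, (1 - f P)) * ∏ P ∈ S, (1 - g P)‖ * (‖∑' I, f I‖ * ‖∑' I, g I‖) := by
        simp only [norm_mul]; ring
    _ ≤ 1 * _ := by gcongr
    _ = _ := one_mul _

theorem norm_three_four_one_le_one {x : ℝ} (hx0 : 0 ≤ x) (hx1 : x < 1) {w : ℂ} (hw : ‖w‖ = 1) :
    ‖(1 - (x : ℂ)) ^ 3 * (1 - x * w) ^ 4 * (1 - x * w ^ 2)‖ ≤ 1 := by
  have hn (v : ℂ) (hv : ‖v‖ = 1) : ‖(x : ℂ) * v‖ < 1 := by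
    rw [norm_mul, hv, mul_one, norm_real, Real.norm_of_nonneg hx0]; exact hx1
  have hlog (v : ℂ) (hv : ‖v‖ = 1) : ‖1 - (x : ℂ) * v‖ = Real.exp (Complex.log (1 - x * v)).re := by
    rw [← norm_exp, exp_log]
    intro h
    have := hn v hv
    rw [← sub_eq_zero.mp h] at this
    simp at this
  have hre (v : ℂ) (hv : ‖v‖ = 1) := (hasSum_re (hasSum_taylorSeries_neg_log (hn v hv)))
  have h2 : ‖w ^ 2‖ = 1 := by simp [hw]
  have key : 0 ≤ 3 * (-Complex.log (1 - x * 1)).re + 4 * (-Complex.log (1 - x * w)).re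
      + (-Complex.log (1 - x * w ^ 2)).re := by
    refine (((hre 1 (by simp)).mul_left 3).add ((hre w hw).mul_left 4) |>.add
      (hre (w ^ 2) h2)).nonneg fun n => ?_
    have e (v : ℂ) : (((x : ℂ) * v) ^ n / n).re = x ^ n / n * (v ^ n).re := by
      rw [mul_pow, mul_div_right_comm]
      rw [show ((x : ℂ) ^ n / n) = ((x ^ n / n : ℝ) : ℂ) by push_cast; rfl, re_ofReal_mul]
    simp only [e]
    set u := w ^ n with hu
    have hun : ‖u‖ = 1 := by simp [hu, hw]
    have hu2 : u.re ^ 2 + u.im ^ 2 = 1 := by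
      have := Complex.sq_norm u
      rw [hun, normSq_apply] at this; nlinarith
    have : ((w ^ 2) ^ n).re = u.re ^ 2 - u.im ^ 2 := by
      rw [← pow_mul, mul_comm, pow_mul, ← hu]; simp [sq]
    rw [this]
    have hxn : 0 ≤ x ^ n / n := by positivity
    simp only [one_pow, one_re]
    nlinarith [mul_nonneg hxn (sq_nonneg (u.re + 1))]
  rw [norm_mul, norm_mul, norm_pow, norm_pow]
  have h1 := hlog 1 (by simp)
  rw [mul_one] at h1 key
  rw [h1, hlog w hw, hlog _ h2, ← Real.exp_nat_mul, ← Real.exp_nat_mul, ← Real.exp_add,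
    ← Real.exp_add, Real.exp_le_one_iff]
  simp only [neg_re] at key
  push_cast
  linarith

theorem one_le_norm_tsum_three_four_one [UniqueFactorizationMonoid M] [Subsingleton Mˣ]
    (f g h : M →*₀ ℂ) (hf : Summable fun I => ‖f I‖)
    (hg : Summable fun I => ‖g I‖) (hh : Summable fun I => ‖h I‖)
    (hfg : ∀ I ≠ 0, ∃ (x : ℝ) (w : ℂ), 0 ≤ x ∧ ‖w‖ = 1 ∧ f I = x ∧ g I = x * w ∧ h I = x * w ^ 2) :
    1 ≤ ‖∑' I, f I‖ ^ 3 * ‖∑' I, g I‖ ^ 4 * ‖∑' I, h I‖ := by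
  have H := ((((tendsto_prod_one_sub_mul f hf).pow 3).mul
    ((tendsto_prod_one_sub_mul g hg).pow 4)).mul (tendsto_prod_one_sub_mul h hh)).norm
  simp only [one_pow, mul_one, norm_one] at H
  refine le_of_tendsto H (Eventually.of_forall fun S => ?_)
  have : ‖(∏ P ∈ S, (1 - f P)) ^ 3 * (∏ P ∈ S, (1 - g P)) ^ 4 * ∏ P ∈ S, (1 - h P)‖ ≤ 1 := by
    rw [← Finset.prod_pow, ← Finset.prod_pow, ← Finset.prod_mul_distrib,
      ← Finset.prod_mul_distrib, norm_prod]
    refine Finset.prod_le_one (fun _ _ => norm_nonneg _) fun P _ => ?_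
    obtain ⟨x, w, hx, hw, h1, h2, h3⟩ := hfg P.1 P.2.ne_zero
    have hlt := norm_apply_lt_one_of_prime f hf P.2
    rw [h1, norm_real, Real.norm_of_nonneg hx] at hlt
    rw [h1, h2, h3]
    exact norm_three_four_one_le_one hx hlt hw
  calc _ = ‖(∏ P ∈ S, (1 - f P)) ^ 3 * (∏ P ∈ S, (1 - g P)) ^ 4 * ∏ P ∈ S, (1 - h P)‖ *
          (‖∑' I, f I‖ ^ 3 * ‖∑' I, g I‖ ^ 4 * ‖∑' I, h I‖) := by
        simp only [norm_mul, norm_pow]; ring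
    _ ≤ 1 * _ := by gcongr
    _ = _ := one_mul _

end Euler

section Lattice

open MeasureTheory Metric

/-- The number of points of a planar lattice in a large ball. -/
theorem exists_abs_card_lattice_sub_le {E ι : Type*} [NormedAddCommGroup E] [NormedSpace ℝ E]
    [FiniteDimensional ℝ E] [Finite ι] (b : Module.Basis ι ℝ E) (hE : Module.finrank ℝ E = 2) :
    ∃ κ C : ℝ, ∀ R : ℝ, 0 ≤ R →
      |(Set.ncard (closedBall (0 : E) R ∩ Submodule.span ℤ (Set.range b)) : ℝ) - κ * R ^ 2|
        ≤ C * (1 + R) := by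
  classical
  have : Fintype ι := Fintype.ofFinite ι
  have : ProperSpace E := FiniteDimensional.proper_real E
  borelize E
  let μ : Measure E := Measure.addHaar
  set F := ZSpan.fundamentalDomain b with hF
  have hFm : MeasurableSet F := ZSpan.fundamentalDomain_measurableSet b
  obtain ⟨d, hd⟩ := (ZSpan.fundamentalDomain_isBounded b).subset_closedBall (0 : E)
  have hd' : ∀ x ∈ F, ‖x‖ ≤ d := fun x hx => by simpa using hd hx
  have hd0 : 0 ≤ d := (norm_nonneg _).trans
    (hd' (ZSpan.fract b 0) (ZSpan.fract_mem_fundamentalDomain b 0))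
  have hFfin : μ F ≠ ⊤ := (ZSpan.fundamentalDomain_isBounded b).measure_lt_top.ne
  set V := μ.real F with hV
  have hVpos : 0 < V :=
    ENNReal.toReal_pos (ZSpan.measure_fundamentalDomain_ne_zero b) hFfin
  set B := μ.real (ball (0 : E) 1) with hB
  have hB0 : 0 ≤ B := measureReal_nonneg
  have hball (r : ℝ) (hr : 0 ≤ r) : μ.real (closedBall (0 : E) r) = r ^ 2 * B := by
    rw [Measure.addHaar_real_closedBall μ 0 hr, hE]
  refine ⟨B / V, B * (2 * d + d ^ 2) / V, fun R hR => ?_⟩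
  have hfin := ZSpan.setFinite_inter b (s := closedBall (0 : E) R) isBounded_closedBall
  rw [Set.ncard_eq_toFinset_card _ hfin]
  set S := hfin.toFinset with hS
  have hmem (v : E) : v ∈ S ↔ ‖v‖ ≤ R ∧ v ∈ Submodule.span ℤ (Set.range b) := by simp [hS]
  set U : Set E := ⋃ v ∈ S, (fun x => -v + x) ⁻¹' F with hU
  have hUm : μ.real U = S.card * V := by
    have hne (v : E) : μ ((fun x => -v + x) ⁻¹' F) ≠ ⊤ := by rwa [measure_preimage_add]
    rw [hU, measureReal_biUnion_finset (h := fun v _ => hne v)]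
    · simp [measureReal_def, measure_preimage_add, hV]
    · intro v hv w hw hvw
      refine Set.disjoint_left.mpr fun x hx hx' => hvw ?_
      have h := ZSpan.exist_unique_vadd_mem_fundamentalDomain b x
      have := h.unique (y₁ := ⟨-v, neg_mem ((hmem v).mp hv).2⟩)
        (y₂ := ⟨-w, neg_mem ((hmem w).mp hw).2⟩) hx hx'
      simpa using this
    · exact fun v _ => measurable_const_add (-v) hFm
  have hup : U ⊆ closedBall 0 (R + d) := by
    intro x hx
    simp only [hU, Set.mem_iUnion, Set.mem_preimage] at hx
    obtain ⟨v, hv, hx⟩ := hx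
    rw [mem_closedBall_zero_iff]
    calc ‖x‖ = ‖v + (-v + x)‖ := by rw [add_neg_cancel_left]
      _ ≤ _ := (norm_add_le _ _).trans (add_le_add ((hmem v).mp hv).1 (hd' _ hx))
  have hlow : closedBall 0 (R - d) ⊆ U := by
    intro x hx
    rw [mem_closedBall_zero_iff] at hx
    simp only [hU, Set.mem_iUnion, Set.mem_preimage]
    refine ⟨ZSpan.floor b x, (hmem _).mpr ⟨?_, (ZSpan.floor b x).2⟩, ?_⟩
    · have h1 : (ZSpan.floor b x : E) = x - ZSpan.fract b x := by simp [ZSpan.fract_apply]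
      rw [h1]
      have := norm_sub_le x (ZSpan.fract b x)
      have := hd' _ (ZSpan.fract_mem_fundamentalDomain b x)
      linarith
    · rw [neg_add_eq_sub]
      exact ZSpan.fract_mem_fundamentalDomain b x
  have h1 : S.card * V ≤ (R + d) ^ 2 * B := by
    rw [← hUm, ← hball _ (by positivity)]
    exact measureReal_mono hup isBounded_closedBall.measure_lt_top.ne
  have h2 : (R ^ 2 - 2 * d * R) * B ≤ S.card * V := by
    rcases le_total d R with h | h
    · have : (R - d) ^ 2 * B ≤ S.card * V := by
        rw [← hUm, ← hball _ (by linarith)]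
        exact measureReal_mono hlow
          (ne_top_of_le_ne_top isBounded_closedBall.measure_lt_top.ne (measure_mono hup))
      nlinarith [mul_nonneg (sq_nonneg d) hB0]
    · have : 0 ≤ (S.card : ℝ) * V := by positivity
      nlinarith [mul_nonneg (mul_nonneg hd0 hR) hB0, mul_nonneg (mul_nonneg hR (sub_nonneg.2 h)) hB0]
  have e : (S.card : ℝ) - B / V * R ^ 2 = (S.card * V - B * R ^ 2) / V := by
    field_simp
  rw [e, abs_div, abs_of_pos hVpos, div_mul_eq_mul_div]
  gcongr
  rw [abs_le]
  have p1 := mul_nonneg hB0 hd0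
  have p2 := mul_nonneg hB0 (sq_nonneg d)
  constructor <;> nlinarith [mul_nonneg p1 hR, mul_nonneg p2 hR]

end Lattice

section Count

variable (K : Type*) [Field K] [NumberField K]

open mixedEmbedding
open scoped Classical

theorem finrank_mixedSpace_eq_two (hdeg : Module.finrank ℚ K = 2) :
    Module.finrank ℝ (mixedSpace K) = 2 := by
  rw [mixedEmbedding.finrank, hdeg]

theorem mixedEmbedding_norm_eq_sq (hdeg : Module.finrank ℚ K = 2)
    (himag : ∀ v : InfinitePlace K, v.IsComplex) (x : mixedSpace K) :
    mixedEmbedding.norm x = ‖x‖ ^ 2 := by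
  have hcard : Fintype.card (InfinitePlace K) = 1 := by
    have h := InfinitePlace.sum_mult_eq (K := K)
    simp only [fun w => InfinitePlace.mult_isComplex (⟨w, himag w⟩ : {w // w.IsComplex}), hdeg,
      Finset.sum_const, Finset.card_univ, smul_eq_mul] at h
    omega
  obtain ⟨w, hw⟩ := Fintype.card_eq_one_iff.mp hcard
  have huniv : (Finset.univ : Finset (InfinitePlace K)) = {w} := by
    ext v; simp [hw v]
  rw [mixedEmbedding.norm_apply, norm_eq_sup'_normAtPlace]
  simp only [huniv, Finset.prod_singleton, Finset.sup'_singleton]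
  rw [InfinitePlace.mult_isComplex (⟨w, himag w⟩ : {w // w.IsComplex})]

theorem absNorm_span_singleton_eq_sq (hdeg : Module.finrank ℚ K = 2)
    (himag : ∀ v : InfinitePlace K, v.IsComplex) (α : 𝓞 K) :
    (Ideal.absNorm (Ideal.span {α}) : ℝ) = ‖mixedEmbedding K (α : K)‖ ^ 2 := by
  rw [← mixedEmbedding_norm_eq_sq K hdeg himag, norm_eq_norm, Ideal.absNorm_span_singleton,
    ← Algebra.coe_norm_int α]
  simp [Nat.cast_natAbs]

/-- Over a principal ideal domain, nonzero elements are pairs of a nonzero ideal and a unit. -/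
theorem card_ideal_mul_card_units {R : Type*} [CommRing R] [IsDomain R] [IsPrincipalIdealRing R]
    (p : Ideal R → Prop) :
    Nat.card {I : Ideal R // I ≠ ⊥ ∧ p I} * Nat.card Rˣ =
      Nat.card {α : R // α ≠ 0 ∧ p (Ideal.span {α})} := by
  rw [← Nat.card_prod]
  have hgen (I : Ideal R) : Ideal.span {Submodule.IsPrincipal.generator I} = I :=
    Submodule.IsPrincipal.span_singleton_generator I
  have hspan (I : Ideal R) (u : Rˣ) :
      Ideal.span {Submodule.IsPrincipal.generator I * (u : R)} = I := by
    rw [Ideal.span_singleton_mul_right_unit u.isUnit, hgen]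
  have hne (I : Ideal R) (hI : I ≠ ⊥) : Submodule.IsPrincipal.generator I ≠ 0 := fun h =>
    hI (by rw [← hgen I, h]; simp)
  refine Nat.card_congr (Equiv.ofBijective (fun x =>
    ⟨Submodule.IsPrincipal.generator x.1.1 * (x.2 : R),
      mul_ne_zero (hne _ x.1.2.1) x.2.ne_zero, by rw [hspan]; exact x.1.2.2⟩) ⟨?_, ?_⟩)
  · rintro ⟨⟨I, hI⟩, u⟩ ⟨⟨J, hJ⟩, v⟩ h
    have h' : Submodule.IsPrincipal.generator I * (u : R) =
      Submodule.IsPrincipal.generator J * (v : R) := congrArg Subtype.val h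
    obtain rfl : I = J := by rw [← hspan I u, h', hspan J v]
    have := mul_left_cancel₀ (hne I hI.1) h'
    rw [Units.ext this]
  · rintro ⟨α, hα, hp⟩
    obtain ⟨u, hu⟩ := Ideal.span_singleton_eq_span_singleton.mp (hgen (Ideal.span {α}))
    exact ⟨⟨⟨Ideal.span {α}, by simpa using hα, hp⟩, u⟩, Subtype.ext hu⟩

/-- The number of nonzero ideals of bounded norm, with a power saving error term. -/
theorem exists_abs_card_ideal_sub_le (hdeg : Module.finrank ℚ K = 2)
    (himag : ∀ v : InfinitePlace K, v.IsComplex) [IsPrincipalIdealRing (𝓞 K)] :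
    ∃ κ C : ℝ, ∀ x : ℝ, 0 ≤ x →
      |(Nat.card {I : Ideal (𝓞 K) // I ≠ ⊥ ∧ (Ideal.absNorm I : ℝ) ≤ x} : ℝ) - κ * x|
        ≤ C * (1 + √x) := by
  obtain ⟨κ, C, h⟩ := exists_abs_card_lattice_sub_le (latticeBasis K)
    (finrank_mixedSpace_eq_two K hdeg)
  set w := Nat.card (𝓞 K)ˣ with hw
  have hinj : Function.Injective fun α : 𝓞 K => mixedEmbedding K (α : K) :=
    (mixedEmbedding_injective K).comp RingOfIntegers.coe_injective
  have hset (x : ℝ) (hx : 0 ≤ x) : (fun α : 𝓞 K => mixedEmbedding K (α : K)) ''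
      (insert 0 {α | α ≠ 0 ∧ (Ideal.absNorm (Ideal.span {α}) : ℝ) ≤ x}) =
      Metric.closedBall 0 √x ∩ Submodule.span ℤ (Set.range (latticeBasis K)) := by
    ext v
    simp only [absNorm_span_singleton_eq_sq K hdeg himag, Set.mem_image, Set.mem_inter_iff,
      mem_closedBall_zero_iff, SetLike.mem_coe, mem_span_latticeBasis, Set.mem_insert_iff,
      Set.mem_ofPred_eq]
    constructor
    · rintro ⟨α, hα | hα, rfl⟩
      · subst hα
        exact ⟨by simp, 0, by simp⟩
      · exact ⟨Real.le_sqrt_of_sq_le hα.2, α, rfl⟩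
    · rintro ⟨hv, α, rfl⟩
      refine ⟨α, ?_, rfl⟩
      by_cases h0 : α = 0
      · exact Or.inl h0
      · exact Or.inr ⟨h0, (Real.le_sqrt (norm_nonneg _) hx).mp hv⟩
  have hfin (x : ℝ) (hx : 0 ≤ x) :
      {α : 𝓞 K | α ≠ 0 ∧ (Ideal.absNorm (Ideal.span {α}) : ℝ) ≤ x}.Finite := by
    refine Set.Finite.subset ?_ (Set.subset_insert 0 _)
    refine Set.Finite.of_finite_image ?_ hinj.injOn
    rw [hset x hx]
    exact ZSpan.setFinite_inter _ Metric.isBounded_closedBall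
  have hw0 : 0 < (w : ℝ) := by
    have : Finite (𝓞 K)ˣ := by
      have := (hfin 1 zero_le_one).to_subtype
      refine Finite.of_injective (β := {α : 𝓞 K | α ≠ 0 ∧
        (Ideal.absNorm (Ideal.span {α}) : ℝ) ≤ 1}) (fun u => ⟨u, u.ne_zero, ?_⟩) fun u v huv => ?_
      · rw [Ideal.span_singleton_eq_top.mpr u.isUnit]; simp
      · exact Units.ext (congrArg Subtype.val huv)
    exact_mod_cast Nat.card_pos
  refine ⟨κ / w, (C + 1) / w, fun x hx => ?_⟩
  have h1 := card_ideal_mul_card_units (R := 𝓞 K) (fun I => (Ideal.absNorm I : ℝ) ≤ x)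
  have h2 := h √x (Real.sqrt_nonneg _)
  rw [← hset x hx, Set.ncard_image_of_injective _ hinj,
    Set.ncard_insert_of_notMem (by simp) (hfin x hx), Real.sq_sqrt hx] at h2
  have h3 : (Set.ncard {α : 𝓞 K | α ≠ 0 ∧ (Ideal.absNorm (Ideal.span {α}) : ℝ) ≤ x} : ℝ) =
      Nat.card {I : Ideal (𝓞 K) // I ≠ ⊥ ∧ (Ideal.absNorm I : ℝ) ≤ x} * w := by
    exact_mod_cast h1.symm
  push_cast at h2
  rw [h3] at h2
  set N : ℝ :=
    ((Nat.card {I : Ideal (𝓞 K) // I ≠ ⊥ ∧ (Ideal.absNorm I : ℝ) ≤ x} : ℕ) : ℝ)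
  have e : N - κ / w * x = (N * w - κ * x) / w := by field_simp
  rw [e, abs_div, abs_of_pos hw0, div_mul_eq_mul_div]
  gcongr
  have := Real.sqrt_nonneg x
  rw [abs_le] at h2 ⊢
  constructor <;> linarith

end Count

section Continuation

open MeasureTheory

/-- The Mellin transform of a function of size `O(√t)` supported on `t > 1`. -/
theorem mellin_indicator_of_le_sqrt {E : ℝ → ℂ} (hE : Measurable E) {M : ℝ} (hM : 0 ≤ M)
    (hEM : ∀ t, 1 < t → ‖E t‖ ≤ M * √t) :
    (∀ s : ℂ, 1 / 2 < s.re →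
      DifferentiableAt ℂ (fun s : ℂ => ∫ t in Set.Ioi (1 : ℝ), E t * (t : ℂ) ^ (-(s + 1))) s) ∧
    (∀ s : ℂ, 1 / 2 < s.re →
      IntegrableOn (fun t : ℝ => E t * (t : ℂ) ^ (-(s + 1))) (Set.Ioi 1)) ∧
    ∀ s : ℂ, 1 / 2 < s.re →
      ‖∫ t in Set.Ioi (1 : ℝ), E t * (t : ℂ) ^ (-(s + 1))‖ ≤ M / (s.re - 1 / 2) := by
  have hb (s : ℂ) (hs : 1 / 2 < s.re) (t : ℝ) (ht : t ∈ Set.Ioi (1 : ℝ)) :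
      ‖E t * (t : ℂ) ^ (-(s + 1))‖ ≤ M * t ^ (-(s.re + 1 / 2)) := by
    have ht0 : 0 < t := one_pos.trans ht
    rw [norm_mul, norm_cpow_eq_rpow_re_of_pos ht0]
    calc _ ≤ M * √t * t ^ (-(s + 1)).re := by gcongr; exact hEM t ht
      _ = _ := by
        rw [Real.sqrt_eq_rpow, mul_assoc, ← Real.rpow_add ht0]
        congr 2
        simp; ring
  have hint (s : ℂ) (hs : 1 / 2 < s.re) :
      IntegrableOn (fun t : ℝ => M * t ^ (-(s.re + 1 / 2))) (Set.Ioi 1) :=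
    (integrableOn_Ioi_rpow_of_lt (by linarith) one_pos).const_mul M
  have hmeas (s : ℂ) : Measurable fun t : ℝ => E t * (t : ℂ) ^ (-(s + 1)) := by fun_prop
  set g : ℝ → ℂ := (Set.Ioi (1 : ℝ)).indicator E with hg
  have hgM (t : ℝ) : ‖g t‖ ≤ M * √t := by
    by_cases h : t ∈ Set.Ioi (1 : ℝ)
    · rw [hg, Set.indicator_of_mem h]; exact hEM t h
    · rw [hg, Set.indicator_of_notMem h]; simp; positivity
  have hloc : LocallyIntegrableOn g (Set.Ioi 0) := by
    have h1 : LocallyIntegrable (fun t : ℝ => M * √t) :=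
      (by fun_prop : Continuous fun t : ℝ => M * √t).locallyIntegrable
    refine (h1.mono (hE.indicator measurableSet_Ioi).aestronglyMeasurable
      (Eventually.of_forall fun t => ?_)).locallyIntegrableOn _
    exact (hgM t).trans (le_abs_self _)
  have hbot : g =ᶠ[𝓝[>] 0] 0 := by
    filter_upwards [nhdsWithin_le_nhds (Iio_mem_nhds one_pos)] with t ht
    exact Set.indicator_of_notMem (fun h => absurd ht (not_lt.mpr (le_of_lt h))) _
  have hmel (s : ℂ) : ∫ t in Set.Ioi (1 : ℝ), E t * (t : ℂ) ^ (-(s + 1)) = mellin g (-s) := by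
    rw [mellin, ← integral_indicator measurableSet_Ioi, ← integral_indicator measurableSet_Ioi]
    refine integral_congr_ae (Eventually.of_forall fun t => ?_)
    simp only [hg, Set.indicator_apply, Set.mem_Ioi, smul_eq_mul]
    by_cases h : 1 < t
    · simp only [h, one_pos.trans h, if_true]
      rw [mul_comm, neg_add']
    · simp [h]
  refine ⟨fun s hs => ?_, fun s hs => ?_, fun s hs => ?_⟩
  · simp_rw [hmel]
    refine DifferentiableAt.comp (g := mellin g) s
      (mellin_differentiableAt_of_isBigO_rpow (a := -(1 / 2)) (b := -s.re - 1) hloc ?_ ?_ ?_ ?_)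
      (by fun_prop)
    · refine Asymptotics.IsBigO.of_bound M ?_
      filter_upwards [eventually_gt_atTop 0] with t ht
      rw [neg_neg, ← Real.sqrt_eq_rpow, Real.norm_of_nonneg (Real.sqrt_nonneg _)]
      exact hgM t
    · simp only [neg_re]; linarith
    · exact hbot.trans_isBigO (Asymptotics.isBigO_zero _ _)
    · simp
  · exact Integrable.mono' (hint s hs) (hmeas s).aestronglyMeasurable
      ((ae_restrict_iff' measurableSet_Ioi).mpr (Eventually.of_forall (hb s hs)))
  · refine (norm_integral_le_of_norm_le (hint s hs)
      ((ae_restrict_iff' measurableSet_Ioi).mpr (Eventually.of_forall (hb s hs)))).trans_eq ?_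
    rw [integral_const_mul, integral_Ioi_rpow_of_lt (by linarith) one_pos, Real.one_rpow,
      neg_div, ← div_neg, mul_one_div]
    congr 1
    ring

/-- Analytic continuation to `Re s > 1/2` of a Dirichlet series whose summatory function is linear
up to `O(√t)`. -/
theorem LSeries_eq_of_abs_sum_sub_le {f : ℕ → ℝ} (hf : ∀ n, 0 ≤ f n) {κ C : ℝ}
    (h : ∀ t : ℝ, 1 ≤ t → |∑ k ∈ Finset.Icc 1 ⌊t⌋₊, f k - κ * t| ≤ C * (1 + √t)) :
    (∀ s : ℂ, 1 < s.re → LSeriesSummable (fun n => (f n : ℂ)) s) ∧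
    ∃ H : ℂ → ℂ, ∃ M : ℝ, 0 ≤ M ∧ (∀ s : ℂ, 1 / 2 < s.re → DifferentiableAt ℂ H s) ∧
      (∀ s : ℂ, 1 / 2 < s.re → ‖H s‖ ≤ M / (s.re - 1 / 2)) ∧
      ∀ s : ℂ, 1 < s.re → LSeries (fun n => (f n : ℂ)) s = κ * s / (s - 1) + s * H s := by
  have hC : 0 ≤ C := by
    have := (abs_nonneg _).trans (h 1 le_rfl)
    norm_num at this
    linarith
  have hO : (fun n => ∑ k ∈ Finset.Icc 1 n, f k) =O[atTop] fun n : ℕ => (n : ℝ) ^ (1 : ℝ) := by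
    refine Asymptotics.IsBigO.of_bound (|κ| + 2 * C) ?_
    filter_upwards [eventually_ge_atTop 1] with n hn
    have hn1 : (1 : ℝ) ≤ n := by exact_mod_cast hn
    have h1 := h n hn1
    rw [Nat.floor_natCast] at h1
    have h2 : √(n : ℝ) ≤ n := (Real.sqrt_le_left (by positivity)).mpr (by nlinarith)
    rw [Real.rpow_one, Real.norm_eq_abs, Real.norm_of_nonneg (by positivity)]
    have h3 := abs_sub_abs_le_abs_sub (∑ k ∈ Finset.Icc 1 n, f k) (κ * n)
    rw [abs_mul κ, abs_of_nonneg (by positivity : (0 : ℝ) ≤ n)] at h3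
    nlinarith
  refine ⟨fun s hs => LSeriesSummable_of_sum_norm_bigO_and_nonneg hO hf zero_le_one hs, ?_⟩
  set E : ℝ → ℂ := fun t => ((∑ k ∈ Finset.Icc 1 ⌊t⌋₊, f k - κ * t : ℝ) : ℂ) with hE
  have hEm : Measurable E := by
    have : Measurable fun t : ℝ => ∑ k ∈ Finset.Icc 1 ⌊t⌋₊, f k :=
      (measurable_from_nat (f := fun n => ∑ k ∈ Finset.Icc 1 n, f k)).comp Nat.measurable_floor
    fun_prop
  have hEM (t : ℝ) (ht : 1 < t) : ‖E t‖ ≤ 2 * C * √t := by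
    rw [hE, norm_real, Real.norm_eq_abs]
    have := Real.one_le_sqrt.mpr ht.le
    refine (h t ht.le).trans ?_
    nlinarith
  obtain ⟨h1, h2, h3⟩ := mellin_indicator_of_le_sqrt hEm (by positivity) hEM
  refine ⟨_, 2 * C, by positivity, h1, h3, fun s hs => ?_⟩
  rw [LSeries_eq_mul_integral_of_nonneg f zero_le_one hs hO hf, mul_comm (κ : ℂ) s, mul_div_assoc,
    ← mul_add]
  congr 1
  have hs' : (-s).re < -1 := by simpa using hs
  have h4 : ∫ t in Set.Ioi (1 : ℝ), (t : ℂ) ^ (-s) = 1 / (s - 1) := by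
    rw [integral_Ioi_cpow_of_lt hs' one_pos, ofReal_one, one_cpow, ← neg_div_neg_eq]
    congr 1
    · simp
    · ring
  rw [div_eq_mul_one_div, ← h4, ← integral_const_mul, ← integral_add
    ((integrableOn_Ioi_cpow_of_lt hs' one_pos).const_mul _) (h2 s (by linarith))]
  refine setIntegral_congr_fun measurableSet_Ioi fun t ht => ?_
  have ht0 : (t : ℂ) ≠ 0 := by exact_mod_cast (one_pos.trans ht).ne'
  simp only [hE]
  rw [show -s = -(s + 1) + 1 by ring, cpow_add _ _ ht0, cpow_one]
  push_cast
  ring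

end Continuation

section Zeta

variable (K : Type*) [Field K] [NumberField K]

/-- The completely multiplicative function `I ↦ N(I)^{-s}` on ideals. -/
noncomputable def idealCpow (s : ℂ) (hs : s ≠ 0) : Ideal (𝓞 K) →*₀ ℂ where
  toFun I := (Ideal.absNorm I : ℂ) ^ (-s)
  map_zero' := by
    rw [Ideal.zero_eq_bot, Ideal.absNorm_bot, Nat.cast_zero, zero_cpow (neg_ne_zero.mpr hs)]
  map_one' := by simp
  map_mul' I J := by rw [map_mul, Nat.cast_mul, natCast_mul_natCast_cpow]

theorem idealCpow_apply {s : ℂ} (hs : s ≠ 0) (I : Ideal (𝓞 K)) :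
    idealCpow K s hs I = (Ideal.absNorm I : ℂ) ^ (-s) := rfl

variable {K} in
theorem absNorm_pos_of_ne_bot {I : Ideal (𝓞 K)} (hI : I ≠ ⊥) : 0 < Ideal.absNorm I :=
  Nat.pos_of_ne_zero fun h => hI (Ideal.absNorm_eq_zero_iff.mp h)

theorem dedekindZetaSum_eq_tsum {s : ℂ} (hs : s ≠ 0) :
    dedekindZetaSum K s = ∑' I, idealCpow K s hs I := by
  refine Subtype.val_injective.tsum_eq (f := idealCpow K s hs) fun I hI => ?_
  refine ⟨⟨I, ?_⟩, rfl⟩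
  rintro rfl
  exact hI (map_zero (idealCpow K s hs))

theorem norm_idealCpow {s : ℂ} (hs : 1 < s.re) (I : Ideal (𝓞 K)) :
    (idealCpow K (s.re : ℂ) (ne_zero_of_one_lt_re (by simpa using hs)) I) =
      (‖idealCpow K s (ne_zero_of_one_lt_re hs) I‖ : ℂ) := by
  by_cases hI : I = ⊥
  · subst hI
    simp only [← Ideal.zero_eq_bot, map_zero, norm_zero, ofReal_zero]
  · rw [idealCpow_apply, idealCpow_apply, norm_natCast_cpow_of_pos (absNorm_pos_of_ne_bot hI),
      neg_re, ofReal_cpow (by positivity)]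
    simp

/-- The number of ideals of norm `n`. -/
noncomputable def idealCount (n : ℕ) : ℝ := Nat.card {I : Ideal (𝓞 K) // Ideal.absNorm I = n}

theorem sum_idealCount (n : ℕ) : ∑ k ∈ Finset.Icc 1 n, idealCount K k =
    Nat.card {I : Ideal (𝓞 K) // I ≠ ⊥ ∧ Ideal.absNorm I ≤ n} := by
  simp only [idealCount, ← Nat.cast_sum]
  congr 1
  have := Finset.card_preimage_eq_sum_card_image_eq (f := fun I : Ideal (𝓞 K) => Ideal.absNorm I)
    (s := Finset.Icc 1 n) (fun k _ => Ideal.finite_setOfPred_absNorm_eq k)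
  rw [← this]
  refine Nat.card_congr (Equiv.subtypeEquivRight fun I => ?_)
  simp [Nat.one_le_iff_ne_zero, Ideal.absNorm_eq_zero_iff]

theorem tsum_idealCpow_fiber {s : ℂ} (hs : s ≠ 0) (n : ℕ) :
    ∑' I : {I : Ideal (𝓞 K) // Ideal.absNorm I = n}, idealCpow K s hs I =
      LSeries.term (fun n => (idealCount K n : ℂ)) s n := by
  have h (I : {I : Ideal (𝓞 K) // Ideal.absNorm I = n}) :
      idealCpow K s hs I = (n : ℂ) ^ (-s) := by rw [idealCpow_apply, I.2]
  simp only [h, tsum_const, nsmul_eq_mul]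
  rcases eq_or_ne n 0 with rfl | hn
  · simp [zero_cpow (neg_ne_zero.mpr hs)]
  · rw [LSeries.term_of_ne_zero hn, cpow_neg, div_eq_mul_inv, idealCount]
    simp

theorem summable_idealCpow {s : ℂ} (hs : 1 < s.re)
    (hsum : LSeriesSummable (fun n => (idealCount K n : ℂ)) s.re) :
    Summable fun I => ‖idealCpow K s (ne_zero_of_one_lt_re hs) I‖ := by
  rw [← (Equiv.sigmaFiberEquiv fun I : Ideal (𝓞 K) => Ideal.absNorm I).summable_iff,
    summable_sigma_of_nonneg (fun _ => by simp only [Function.comp_apply]; exact norm_nonneg _)]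
  refine ⟨fun n => ?_, ?_⟩
  · have : Finite {I : Ideal (𝓞 K) // Ideal.absNorm I = n} :=
      (Ideal.finite_setOfPred_absNorm_eq n).to_subtype
    exact Summable.of_finite
  · refine (summable_norm_iff.mpr hsum).congr fun n => ?_
    rw [← tsum_idealCpow_fiber K (ne_zero_of_one_lt_re (by simpa using hs))]
    simp only [norm_idealCpow K hs, ← ofReal_tsum, norm_real]
    exact Real.norm_of_nonneg (tsum_nonneg fun _ => norm_nonneg _)

theorem dedekindZetaSum_eq_LSeries {s : ℂ} (hs : 1 < s.re)
    (hsum : LSeriesSummable (fun n => (idealCount K n : ℂ)) s.re) :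
    dedekindZetaSum K s = LSeries (fun n => (idealCount K n : ℂ)) s := by
  have h := (summable_idealCpow K hs hsum).of_norm
  rw [dedekindZetaSum_eq_tsum K (ne_zero_of_one_lt_re hs),
    ← (Equiv.sigmaFiberEquiv fun I : Ideal (𝓞 K) => Ideal.absNorm I).tsum_eq, LSeries]
  refine (((Equiv.sigmaFiberEquiv fun I : Ideal (𝓞 K) =>
    Ideal.absNorm I).summable_iff.mpr h).tsum_sigma).trans ?_
  exact tsum_congr fun n => tsum_idealCpow_fiber K (ne_zero_of_one_lt_re hs) n

/-- The analytic properties of a Dedekind zeta function used below. -/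
structure ZetaProperties (Z : ℂ → ℂ) : Prop where
  continuation : ∃ κ : ℝ, ∃ H : ℂ → ℂ, ∃ M : ℝ, 0 ≤ M ∧
    (∀ s : ℂ, 1 / 2 < s.re → DifferentiableAt ℂ H s) ∧
    (∀ s : ℂ, 1 / 2 < s.re → ‖H s‖ ≤ M / (s.re - 1 / 2)) ∧
    ∀ s : ℂ, 1 < s.re → Z s = κ * s / (s - 1) + s * H s
  one_le_norm_mul_norm : ∀ s : ℂ, 1 < s.re → 1 ≤ ‖Z s‖ * ‖Z s.re‖
  three_four_one : ∀ x t : ℝ, 1 < x →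
    1 ≤ ‖Z x‖ ^ 3 * ‖Z (x + t * I)‖ ^ 4 * ‖Z (x + 2 * t * I)‖
  conj : ∀ s : ℂ, 1 < s.re → Z (starRingEnd ℂ s) = starRingEnd ℂ (Z s)
  norm_le_of_le : ∀ s : ℂ, ∀ x : ℝ, 1 < x → x ≤ s.re → ‖Z s‖ ≤ ‖Z x‖

theorem zetaProperties_dedekindZetaSum (hdeg : Module.finrank ℚ K = 2)
    (himag : ∀ v : InfinitePlace K, v.IsComplex) (hclass : classNumber K = 1) :
    ZetaProperties (dedekindZetaSum K) := by
  have : IsPrincipalIdealRing (𝓞 K) := classNumber_eq_one_iff.mp hclass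
  obtain ⟨κ, C, hκ⟩ := exists_abs_card_ideal_sub_le K hdeg himag
  obtain ⟨hS, H, M, hM, hH1, hH2, hH3⟩ := LSeries_eq_of_abs_sum_sub_le (f := idealCount K)
    (fun n => Nat.cast_nonneg _) (κ := κ) (C := C) (fun t ht => by
      rw [sum_idealCount]
      convert! hκ t (by linarith) using 6
      funext I
      rw [Nat.le_floor_iff (by linarith)])
  have hsum (s : ℂ) (hs : 1 < s.re) := summable_idealCpow K hs (hS s.re (by simpa using hs))
  have hZ (s : ℂ) (hs : 1 < s.re) := dedekindZetaSum_eq_tsum K (ne_zero_of_one_lt_re hs)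
  have hre (x : ℝ) (hx : 1 < x) : 1 < (x : ℂ).re := by simpa using hx
  refine ⟨⟨κ, H, M, hM, hH1, hH2, fun s hs => ?_⟩, fun s hs => ?_, fun x t hx => ?_,
    fun s hs => ?_, fun s x hx hxs => ?_⟩
  · rw [dedekindZetaSum_eq_LSeries K hs (hS s.re (by simpa using hs)), hH3 s hs]
  · rw [hZ s hs, hZ _ (hre _ hs)]
    exact one_le_norm_tsum_mul_norm_tsum _ _ (hsum s hs) (hsum _ (hre _ hs)) (norm_idealCpow K hs)
  · have h1 : 1 < ((x : ℂ) + t * I).re := by simpa using hx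
    have h2 : 1 < ((x : ℂ) + 2 * t * I).re := by simpa using hx
    rw [hZ _ (hre x hx), hZ _ h1, hZ _ h2]
    refine one_le_norm_tsum_three_four_one _ _ _ (hsum _ (hre x hx)) (hsum _ h1) (hsum _ h2) ?_
    intro I' hI
    have hpos := absNorm_pos_of_ne_bot hI
    have hne : (Ideal.absNorm I' : ℂ) ≠ 0 := by exact_mod_cast hpos.ne'
    refine ⟨(Ideal.absNorm I' : ℝ) ^ (-x), (Ideal.absNorm I' : ℂ) ^ (-(t * I)), by positivity,
      ?_, ?_, ?_, ?_⟩
    · rw [norm_natCast_cpow_of_pos hpos]; simp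
    · rw [idealCpow_apply, ofReal_cpow (by positivity)]; simp
    · rw [idealCpow_apply, ofReal_cpow (by positivity), neg_add, cpow_add _ _ hne]; simp
    · rw [idealCpow_apply, ofReal_cpow (by positivity), neg_add, cpow_add _ _ hne, ← cpow_nat_mul]
      congr 2 <;> push_cast <;> ring
  · have hs' : 1 < (starRingEnd ℂ s).re := by simpa using hs
    rw [hZ s hs, hZ _ hs', conj_tsum]
    refine tsum_congr fun I => ?_
    rw [idealCpow_apply, idealCpow_apply, ← map_neg, cpow_conj _ _ (by rw [natCast_arg]; exact Real.pi_ne_zero.symm), map_natCast]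
  · rw [hZ s (hx.trans_le hxs), hZ _ (hre x hx)]
    refine (norm_tsum_le_tsum_norm (hsum s (hx.trans_le hxs))).trans ?_
    have : ∑' I, idealCpow K (x : ℂ) (ne_zero_of_one_lt_re (hre x hx)) I =
        ((∑' I, ‖idealCpow K (x : ℂ) (ne_zero_of_one_lt_re (hre x hx)) I‖ : ℝ) : ℂ) := by
      rw [ofReal_tsum]
      exact tsum_congr fun I => norm_idealCpow K (hre x hx) I
    rw [this, norm_real]
    refine le_trans ?_ (le_abs_self _)
    refine (hsum s (hx.trans_le hxs)).tsum_le_tsum (fun I => ?_) (hsum _ (hre x hx))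
    by_cases hI : I = ⊥
    · subst hI
      simp only [← Ideal.zero_eq_bot, map_zero, norm_zero, le_refl]
    · have hpos := absNorm_pos_of_ne_bot hI
      rw [idealCpow_apply, idealCpow_apply, norm_natCast_cpow_of_pos hpos,
        norm_natCast_cpow_of_pos hpos]
      refine Real.rpow_le_rpow_of_exponent_le (by exact_mod_cast hpos) (by simpa using hxs)

end Zeta

section Xi

/-- `ξ` is an entire function with `ξ(1 - s) = ξ(s)` that agrees with `s(s-1)c^s Γ(s)Z(s)` to the
right of the line `Re s = 1` and does not vanish at `1`. -/
structure IsXi (Z : ℂ → ℂ) (c : ℝ) (ξ : ℂ → ℂ) : Prop where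
  pos : 0 < c
  differentiable : Differentiable ℂ ξ
  one_sub : ∀ s : ℂ, ξ (1 - s) = ξ s
  one_ne_zero : ξ 1 ≠ 0
  eq_of_one_lt_re : ∀ s : ℂ, 1 < s.re → ξ s = s * (s - 1) * ((c : ℂ) ^ s * Gamma s * Z s)

theorem IsCompletedDedekindZeta.exists_isXi {K : Type*} [Field K] [NumberField K] {ΛK : ℂ → ℂ}
    (hΛ : IsCompletedDedekindZeta K ΛK) :
    ∃ ξ : ℂ → ℂ, IsXi (dedekindZetaSum K) (Real.sqrt |(discr K : ℝ)| / (2 * Real.pi)) ξ ∧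
      ∀ s : ℂ, s ≠ 0 → s ≠ 1 → ξ s = s * (s - 1) * ΛK s := by
  classical
  obtain ⟨r, hr, hlim⟩ := hΛ.simple_pole_at_one
  set ξ : ℂ → ℂ := fun s => if s = 0 ∨ s = 1 then r else s * (s - 1) * ΛK s with hξ
  have hval : ∀ s : ℂ, s ≠ 0 → s ≠ 1 → ξ s = s * (s - 1) * ΛK s := fun s h0 h1 => by
    simp [hξ, h0, h1]
  have h1 : ξ 1 = r := by simp [hξ]
  have hsymm : ∀ s : ℂ, ξ (1 - s) = ξ s := by
    intro s
    rcases eq_or_ne s 0 with rfl | hs0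
    · simp [hξ]
    rcases eq_or_ne s 1 with rfl | hs1
    · simp [hξ]
    rw [hval s hs0 hs1, hval (1 - s) (sub_ne_zero.2 hs1.symm) (by simpa using hs0),
      ← hΛ.functional_equation]
    ring
  have hopen : IsOpen ({0, 1}ᶜ : Set ℂ) := (Set.toFinite _).isClosed.isOpen_compl
  have hdiff : ∀ s : ℂ, s ≠ 0 → s ≠ 1 → DifferentiableAt ℂ ξ s := by
    intro s hs0 hs1
    have hmem : ({0, 1}ᶜ : Set ℂ) ∈ 𝓝 s := hopen.mem_nhds (by simp [hs0, hs1])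
    have hd : DifferentiableAt ℂ (fun s => s * (s - 1) * ΛK s) s :=
      (by fun_prop : DifferentiableAt ℂ (fun s : ℂ => s * (s - 1)) s).mul
        (hΛ.differentiableOn.differentiableAt hmem)
    refine hd.congr_of_eventuallyEq ?_
    filter_upwards [hmem] with z hz
    simp only [Set.mem_compl_iff, Set.mem_insert_iff, Set.mem_singleton_iff, not_or] at hz
    exact hval z hz.1 hz.2
  have hdiff1 : DifferentiableAt ℂ ξ 1 := by
    refine (analyticAt_of_differentiable_on_punctured_nhds_of_continuousAt ?_ ?_).differentiableAt
    · filter_upwards [self_mem_nhdsWithin, mem_nhdsWithin_of_mem_nhds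
        (isOpen_ne.mem_nhds (one_ne_zero : (1 : ℂ) ≠ 0))] with z hz hz0
      exact hdiff z hz0 hz
    · rw [continuousAt_iff_punctured_nhds, h1]
      have hid : Tendsto (fun s : ℂ => s) (𝓝[≠] 1) (𝓝 1) := tendsto_nhdsWithin_of_tendsto_nhds
        tendsto_id
      have := hid.mul hlim
      rw [one_mul] at this
      refine this.congr' ?_
      filter_upwards [self_mem_nhdsWithin, mem_nhdsWithin_of_mem_nhds
        (isOpen_ne.mem_nhds (one_ne_zero : (1 : ℂ) ≠ 0))] with z hz hz0
      rw [hval z hz0 hz, mul_assoc]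
  have hdiff0 : DifferentiableAt ℂ ξ 0 := by
    have : DifferentiableAt ℂ (fun s : ℂ => ξ (1 - s)) 0 :=
      DifferentiableAt.comp (g := ξ) (f := fun s : ℂ => 1 - s) (0 : ℂ) (by simpa using hdiff1)
        (by fun_prop)
    simpa only [hsymm] using this
  refine ⟨ξ, ⟨?_, fun s => ?_, hsymm, h1 ▸ hr, fun s hs => ?_⟩, hval⟩
  · have : (discr K : ℝ) ≠ 0 := by exact_mod_cast discr_ne_zero K
    positivity
  · rcases eq_or_ne s 0 with rfl | hs0
    · exact hdiff0
    rcases eq_or_ne s 1 with rfl | hs1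
    · exact hdiff1
    exact hdiff s hs0 hs1
  · rw [hval s (by rintro rfl; norm_num at hs) (by rintro rfl; norm_num at hs),
      hΛ.eq_on_gt_one s hs]

variable {Z : ℂ → ℂ} {c : ℝ} {ξ : ℂ → ℂ}

theorem IsXi.ne_zero_of_one_lt_re (h : IsXi Z c ξ) (hZ : ZetaProperties Z) {s : ℂ}
    (hs : 1 < s.re) : ξ s ≠ 0 := by
  have hc : (c : ℂ) ≠ 0 := by exact_mod_cast h.pos.ne'
  have hs0 : s ≠ 0 := by rintro rfl; norm_num at hs
  have hs1 : s ≠ 1 := by rintro rfl; norm_num at hs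
  have hZs : Z s ≠ 0 := fun h0 => by
    have := hZ.one_le_norm_mul_norm s hs
    simp [h0] at this
    linarith
  rw [h.eq_of_one_lt_re s hs]
  exact mul_ne_zero (mul_ne_zero hs0 (sub_ne_zero.2 hs1)) (mul_ne_zero (mul_ne_zero
    (by simp [cpow_eq_zero_iff, hc]) (Gamma_ne_zero_of_re_pos (by linarith))) hZs)

theorem IsXi.ne_zero_of_re_eq_one (h : IsXi Z c ξ) (hZ : ZetaProperties Z) {s : ℂ}
    (hs : s.re = 1) : ξ s ≠ 0 := by
  intro h0
  set t : ℝ := s.im with ht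
  have hs' : s = 1 + t * I := by
    rw [ht, ← re_add_im s, hs]; simp
  have ht0 : t ≠ 0 := by
    intro ht0
    rw [ht0] at hs'
    exact h.one_ne_zero (by simpa [hs'] using h0)
  have hc : (c : ℂ) ≠ 0 := by exact_mod_cast h.pos.ne'
  set W : ℂ → ℂ := fun z => ξ z / (z * (c : ℂ) ^ z * Gamma z) with hW
  have hden : ∀ z : ℂ, 0 < z.re → z * (c : ℂ) ^ z * Gamma z ≠ 0 := fun z hz =>
    mul_ne_zero (mul_ne_zero (by rintro rfl; simp at hz) (by simp [cpow_eq_zero_iff, hc]))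
      (Gamma_ne_zero_of_re_pos hz)
  have hWd : ∀ z : ℂ, 0 < z.re → DifferentiableAt ℂ W z := fun z hz => by
    refine (h.differentiable z).div ?_ (hden z hz)
    refine (differentiableAt_id.mul (differentiableAt_id.const_cpow (Or.inl hc))).mul
      (differentiableAt_Gamma z fun m hm => ?_)
    rw [hm] at hz
    simp at hz
    linarith [(Nat.cast_nonneg m : (0 : ℝ) ≤ m)]
  have hWZ : ∀ z : ℂ, 1 < z.re → W z = (z - 1) * Z z := fun z hz => by
    have := hden z (by linarith)
    rw [hW]
    simp only
    rw [h.eq_of_one_lt_re z hz, div_eq_iff this]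
    ring
  have hW0 : W (1 + t * I) = 0 := by rw [← hs', hW]; simp [h0]
  have hp : ∀ u : ℝ, Tendsto (fun x : ℝ => (x : ℂ) + u * I) (𝓝[>] 1) (𝓝 (1 + u * I)) := by
    intro u
    refine tendsto_nhdsWithin_of_tendsto_nhds ?_
    have : ContinuousAt (fun x : ℝ => (x : ℂ) + u * I) 1 := by fun_prop
    simpa using this.tendsto
  have hcont : ∀ u : ℝ, Tendsto (fun x : ℝ => W ((x : ℂ) + u * I)) (𝓝[>] 1)
      (𝓝 (W (1 + u * I))) := fun u =>
    ((hWd _ (by simp)).continuousAt.tendsto).comp (hp u)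
  have hq : Tendsto (fun x : ℝ => W ((x : ℂ) + t * I) / ((x : ℂ) - 1)) (𝓝[>] 1)
      (𝓝 (deriv W (1 + t * I))) := by
    have h1 := (hWd (1 + t * I) (by simp)).hasDerivAt.tendsto_slope
    have h2 : Tendsto (fun x : ℝ => (x : ℂ) + t * I) (𝓝[>] 1) (𝓝[≠] (1 + t * I)) := by
      refine tendsto_nhdsWithin_iff.2 ⟨hp t, ?_⟩
      filter_upwards [self_mem_nhdsWithin] with x hx hx'
      have := congrArg re hx'
      simp at this
      simp [this] at hx
    refine (h1.comp h2).congr fun x => ?_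
    simp only [Function.comp_apply, slope_def_field, hW0, sub_zero]
    congr 1
    ring
  have hlin : ∀ u : ℝ, Tendsto (fun x : ℝ => ‖(x : ℂ) + u * I - 1‖) (𝓝[>] 1) (𝓝 |u|) := by
    intro u
    have := ((hp u).sub_const 1).norm
    simpa using this
  have hL : Tendsto (fun x : ℝ => ‖(x : ℂ) + t * I - 1‖ ^ 4 * ‖(x : ℂ) + (2 * t : ℝ) * I - 1‖)
      (𝓝[>] 1) (𝓝 (|t| ^ 4 * |2 * t|)) := ((hlin t).pow 4).mul (hlin (2 * t))
  have hx1 : Tendsto (fun x : ℝ => ‖(x : ℂ) - 1‖) (𝓝[>] 1) (𝓝 0) := by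
    simpa using hlin 0
  have hW1 : Tendsto (fun x : ℝ => ‖W x‖) (𝓝[>] 1) (𝓝 ‖W 1‖) := by
    simpa using (hcont 0).norm
  have hR : Tendsto (fun x : ℝ => ‖W x‖ ^ 3 * (‖W ((x : ℂ) + t * I) / ((x : ℂ) - 1)‖ ^ 4 *
      ‖(x : ℂ) - 1‖) * ‖W ((x : ℂ) + (2 * t : ℝ) * I)‖) (𝓝[>] 1)
      (𝓝 (‖W 1‖ ^ 3 * (‖deriv W (1 + t * I)‖ ^ 4 * 0) * ‖W (1 + (2 * t : ℝ) * I)‖)) :=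
    ((hW1.pow 3).mul ((hq.norm.pow 4).mul hx1)).mul (hcont (2 * t)).norm
  have hle := le_of_tendsto_of_tendsto hL hR (by
    filter_upwards [self_mem_nhdsWithin] with x hx
    have hx : 1 < x := hx
    have h341 := hZ.three_four_one x t hx
    have hn : ‖(x : ℂ) - 1‖ = x - 1 := by
      rw [← ofReal_one, ← ofReal_sub, norm_real, Real.norm_of_nonneg (by linarith)]
    have hxp : 0 < x - 1 := by linarith
    rw [hWZ _ (by simpa using hx), hWZ _ (by simpa using hx), hWZ _ (by simpa using hx)]
    simp only [norm_mul, norm_div, hn]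
    have e : ((2 * t : ℝ) : ℂ) = 2 * t := by push_cast; ring
    rw [e]
    have key : ‖(x : ℂ) + t * I - 1‖ ^ 4 * ‖(x : ℂ) + 2 * t * I - 1‖ * 1 ≤
        ‖(x : ℂ) + t * I - 1‖ ^ 4 * ‖(x : ℂ) + 2 * t * I - 1‖ *
        (‖Z x‖ ^ 3 * ‖Z (x + t * I)‖ ^ 4 * ‖Z (x + 2 * t * I)‖) := by gcongr
    rw [mul_one] at key
    refine key.trans (le_of_eq ?_)
    field_simp)
  simp only [mul_zero, zero_mul] at hle
  have : 0 < |t| ^ 4 * |2 * t| := by positivity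
  linarith

theorem IsXi.ne_zero (h : IsXi Z c ξ) (hZ : ZetaProperties Z) {s : ℂ} (hs : 1 ≤ s.re) :
    ξ s ≠ 0 := by
  rcases hs.eq_or_lt with hs | hs
  · exact h.ne_zero_of_re_eq_one hZ hs.symm
  · exact h.ne_zero_of_one_lt_re hZ hs

theorem IsXi.apply_conj (h : IsXi Z c ξ) (hZ : ZetaProperties Z) (s : ℂ) :
    ξ (starRingEnd ℂ s) = starRingEnd ℂ (ξ s) := by
  have hd : Differentiable ℂ (starRingEnd ℂ ∘ ξ ∘ starRingEnd ℂ) := fun z => by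
    have := (h.differentiable (starRingEnd ℂ z)).conj_conj
    simpa using this
  have heq : starRingEnd ℂ ∘ ξ ∘ starRingEnd ℂ = ξ := by
    refine AnalyticOnNhd.eq_of_eventuallyEq (z₀ := 2) (𝕜 := ℂ)
      (fun z _ => hd.analyticAt z) (fun z _ => h.differentiable.analyticAt z) ?_
    have : {z : ℂ | 1 < z.re} ∈ 𝓝 (2 : ℂ) :=
      (isOpen_lt continuous_const continuous_re).mem_nhds (by simp)
    filter_upwards [this] with z hz
    have hz : 1 < z.re := hz
    simp only [Function.comp_apply]
    rw [h.eq_of_one_lt_re _ (by simpa using hz), h.eq_of_one_lt_re _ hz, hZ.conj _ hz, Gamma_conj,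
      cpow_conj _ _ (by rw [arg_ofReal_of_nonneg h.pos.le]; exact Real.pi_ne_zero.symm), conj_ofReal]
    simp
  have := congrFun heq (starRingEnd ℂ s)
  simp only [Function.comp_apply, conj_conj] at this
  exact this.symm

end Xi

section GammaBounds

theorem Complex.norm_Gamma_le_Gamma_re {s : ℂ} (hs : 0 < s.re) : ‖Gamma s‖ ≤ Real.Gamma s.re := by
  rw [Gamma_eq_integral hs, GammaIntegral, Real.Gamma_eq_integral hs]
  refine (MeasureTheory.norm_integral_le_integral_norm _).trans (le_of_eq ?_)
  refine MeasureTheory.setIntegral_congr_fun measurableSet_Ioi fun x hx => ?_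
  have hx : 0 < x := hx
  simp only [norm_mul, norm_real, Real.norm_eq_abs, Real.abs_exp]
  rw [norm_cpow_eq_rpow_re_of_pos hx]
  simp

theorem Complex.exists_norm_Gamma_le {α β : ℝ} (hα : 0 < α) :
    ∃ B : ℝ, 0 ≤ B ∧ ∀ s : ℂ, α ≤ s.re → s.re ≤ β → ‖Gamma s‖ ≤ B := by
  have hcont : ContinuousOn Real.Gamma (Set.Icc α β) := fun x hx =>
    (Real.differentiableAt_Gamma fun m hm => by
      have := hx.1
      rw [hm] at this
      linarith [(Nat.cast_nonneg m : (0 : ℝ) ≤ m)]).continuousAt.continuousWithinAt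
  obtain ⟨B, hB⟩ := isCompact_Icc.exists_bound_of_continuousOn hcont
  refine ⟨max B 0, le_max_right _ _, fun s h1 h2 => ?_⟩
  exact (norm_Gamma_le_Gamma_re (hα.trans_le h1)).trans ((le_abs_self _).trans
    ((hB s.re ⟨h1, h2⟩).trans (le_max_left _ _)))

theorem Complex.norm_sin_le_exp_norm (z : ℂ) : ‖sin z‖ ≤ Real.exp ‖z‖ := by
  have h1 : ‖exp (-z * I)‖ ≤ Real.exp ‖z‖ := by simpa using norm_exp_le_exp_norm (-z * I)
  have h2 : ‖exp (z * I)‖ ≤ Real.exp ‖z‖ := by simpa using norm_exp_le_exp_norm (z * I)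
  rw [sin, norm_div, norm_mul, norm_I, mul_one, RCLike.norm_two, div_le_iff₀ two_pos]
  linarith [norm_sub_le (exp (-z * I)) (exp (z * I))]

theorem Complex.exists_norm_inv_Gamma_le :
    ∃ B : ℝ, 0 ≤ B ∧ ∀ s : ℂ, 1 ≤ s.re → s.re ≤ 3 →
      ‖(Gamma s)⁻¹‖ ≤ B * Real.exp (Real.pi * ‖s‖) := by
  obtain ⟨B, hB0, hB⟩ := exists_norm_Gamma_le (α := 1) (β := 3) one_pos
  obtain ⟨B', hB'⟩ := (isCompact_Icc.reProdIm (isCompact_Icc (a := (-1 : ℝ)) (b := 1))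
    (s := Set.Icc (1 : ℝ) 3)).exists_bound_of_continuousOn
      differentiable_one_div_Gamma.continuous.continuousOn
  refine ⟨max B B', le_max_of_le_left hB0, fun s h1 h3 => ?_⟩
  have hexp : 1 ≤ Real.exp (Real.pi * ‖s‖) := Real.one_le_exp (by positivity)
  rcases le_total |s.im| 1 with him | him
  · have := hB' s ⟨⟨h1, h3⟩, abs_le.1 him⟩
    refine (this.trans (le_max_right B B')).trans (le_mul_of_one_le_right ?_ hexp)
    exact le_max_of_le_left hB0
  · have him0 : s.im ≠ 0 := by
      intro h0
      rw [h0, abs_zero] at him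
      linarith
    have hn : ∀ n : ℝ, 1 ≤ ‖(n : ℂ) - s‖ := fun n => by
      have := abs_im_le_norm ((n : ℂ) - s)
      simp only [sub_im, ofReal_im, zero_sub, abs_neg] at this
      linarith
    have hne : ∀ n : ℝ, (n : ℂ) - s ≠ 0 := fun n h0 => by
      have := hn n
      rw [h0, norm_zero] at this
      linarith
    have g1 : Gamma (4 - s) = (3 - s) * ((2 - s) * ((1 - s) * Gamma (1 - s))) := by
      rw [← Gamma_add_one (1 - s) (by simpa using hne 1), show 1 - s + 1 = 2 - s by ring,
        ← Gamma_add_one (2 - s) (by simpa using hne 2), show 2 - s + 1 = 3 - s by ring,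
        ← Gamma_add_one (3 - s) (by simpa using hne 3), show 3 - s + 1 = 4 - s by ring]
    have g2 : ‖Gamma (1 - s)‖ ≤ B := by
      have h4 := hB (4 - s) (by simp; linarith) (by simp; linarith)
      rw [g1, norm_mul, norm_mul, norm_mul] at h4
      have e1 : 1 ≤ ‖1 - s‖ := by simpa using hn 1
      have e2 : 1 ≤ ‖2 - s‖ := by simpa using hn 2
      have e3 : 1 ≤ ‖3 - s‖ := by simpa using hn 3
      have p := norm_nonneg (Gamma (1 - s))
      calc ‖Gamma (1 - s)‖ ≤ ‖1 - s‖ * ‖Gamma (1 - s)‖ := le_mul_of_one_le_left p e1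
        _ ≤ ‖2 - s‖ * (‖1 - s‖ * ‖Gamma (1 - s)‖) := le_mul_of_one_le_left (by positivity) e2
        _ ≤ ‖3 - s‖ * (‖2 - s‖ * (‖1 - s‖ * ‖Gamma (1 - s)‖)) :=
          le_mul_of_one_le_left (by positivity) e3
        _ ≤ B := h4
    have hπ : (Real.pi : ℂ) ≠ 0 := by exact_mod_cast Real.pi_ne_zero
    have hΓ : Gamma s ≠ 0 := Gamma_ne_zero_of_re_pos (by linarith)
    have hsin : sin (Real.pi * s) ≠ 0 := by
      intro h0
      obtain ⟨k, hk⟩ := sin_eq_zero_iff.1 h0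
      rw [mul_comm, mul_left_inj' hπ] at hk
      exact him0 (by simp [hk])
    have g3 : (Gamma s)⁻¹ = Gamma (1 - s) * sin (Real.pi * s) / Real.pi := by
      have := Gamma_mul_Gamma_one_sub s
      rw [eq_div_iff hsin] at this
      rw [eq_div_iff hπ, inv_mul_eq_iff_eq_mul₀ hΓ]
      linear_combination -this
    have g4 : ‖sin (Real.pi * s)‖ ≤ Real.exp (Real.pi * ‖s‖) := by
      simpa [abs_of_pos Real.pi_pos] using norm_sin_le_exp_norm (Real.pi * s)
    rw [g3, norm_div, norm_mul, norm_real, Real.norm_of_nonneg Real.pi_pos.le]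
    refine (div_le_self (by positivity) (by linarith [Real.pi_gt_three])).trans ?_
    have := le_max_left B B'
    gcongr
    exact g2.trans this

end GammaBounds

section Growth

variable {Z : ℂ → ℂ} {c : ℝ} {ξ : ℂ → ℂ}

theorem IsXi.exists_sub_half_mul_norm_le_right (h : IsXi Z c ξ) (hZ : ZetaProperties Z) :
    ∃ B : ℝ, 0 ≤ B ∧ ∀ s : ℂ, 1 / 2 < s.re → s.re ≤ 3 →
      (s.re - 1 / 2) * ‖ξ s‖ ≤ B * (2 + ‖s‖) ^ 2 := by
  obtain ⟨κ, H, M, hM, hHd, hHb, hZH⟩ := hZ.continuation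
  have hc : (c : ℂ) ≠ 0 := by exact_mod_cast h.pos.ne'
  set U : Set ℂ := {s | 1 / 2 < s.re} with hU
  have hUo : IsOpen U := isOpen_lt continuous_const continuous_re
  set F : ℂ → ℂ := fun s => (c : ℂ) ^ s * Gamma (s + 1) * (κ * s + s * (s - 1) * H s) with hF
  have hFd : ∀ s ∈ U, DifferentiableAt ℂ F s := fun s hs => by
    have hs : 1 / 2 < s.re := hs
    have hG : DifferentiableAt ℂ (fun s => Gamma (s + 1)) s := by
      refine DifferentiableAt.comp (g := Gamma) (f := fun s : ℂ => s + 1) s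
        (differentiableAt_Gamma (s + 1) fun m hm => ?_) (by fun_prop)
      have := congrArg re hm
      simp at this
      linarith [(Nat.cast_nonneg m : (0 : ℝ) ≤ m)]
    have hH := hHd s hs
    have hcp : DifferentiableAt ℂ (fun s : ℂ => (c : ℂ) ^ s) s :=
      differentiableAt_id.const_cpow (Or.inl hc)
    exact (hcp.mul hG).mul (by fun_prop)
  have heq : Set.EqOn ξ F U := by
    refine AnalyticOnNhd.eqOn_of_preconnected_of_eventuallyEq (𝕜 := ℂ) (z₀ := 2)
      (fun z _ => h.differentiable.analyticAt z)
      ((DifferentiableOn.analyticOnNhd fun z hz => (hFd z hz).differentiableWithinAt) hUo)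
      (convex_halfSpace_re_gt _).isPreconnected (by simp [hU]; norm_num) ?_
    have : {z : ℂ | 1 < z.re} ∈ 𝓝 (2 : ℂ) :=
      (isOpen_lt continuous_const continuous_re).mem_nhds (by simp)
    filter_upwards [this] with z hz
    have hz : 1 < z.re := hz
    have hz0 : z ≠ 0 := by rintro rfl; norm_num at hz
    have hz1 : z - 1 ≠ 0 := sub_ne_zero.2 (by rintro rfl; norm_num at hz)
    rw [h.eq_of_one_lt_re z hz, hZH z hz, hF]
    simp only
    rw [Gamma_add_one z hz0]
    field_simp
  obtain ⟨B, hB0, hB⟩ := exists_norm_Gamma_le (α := 1) (β := 4) one_pos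
  refine ⟨(1 + c) ^ (3 : ℝ) * B * (3 * |κ| + M), by have := h.pos; positivity, fun s h1 h3 => ?_⟩
  have hcs : ‖(c : ℂ) ^ s‖ ≤ (1 + c) ^ (3 : ℝ) := by
    rw [norm_cpow_eq_rpow_re_of_pos h.pos]
    calc c ^ s.re ≤ (1 + c) ^ s.re :=
        Real.rpow_le_rpow h.pos.le (by linarith) (by linarith)
      _ ≤ _ := Real.rpow_le_rpow_of_exponent_le (by linarith [h.pos]) h3
  have hΓ : ‖Gamma (s + 1)‖ ≤ B := hB _ (by simp; linarith) (by simp; linarith)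
  have hx : 0 < s.re - 1 / 2 := by linarith
  have hHs : (s.re - 1 / 2) * ‖H s‖ ≤ M := by
    have := hHb s h1
    rwa [le_div_iff₀ hx, mul_comm] at this
  have hs1 : ‖s - 1‖ ≤ ‖s‖ + 1 := by simpa using norm_sub_le s 1
  have hsum : (s.re - 1 / 2) * ‖(κ : ℂ) * s + s * (s - 1) * H s‖ ≤
      (3 * |κ| + M) * (2 + ‖s‖) ^ 2 := by
    have n1 : ‖(κ : ℂ) * s + s * (s - 1) * H s‖ ≤ |κ| * ‖s‖ + ‖s‖ * (‖s‖ + 1) * ‖H s‖ := by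
      refine (norm_add_le _ _).trans ?_
      rw [norm_mul, norm_mul, norm_mul, norm_real, Real.norm_eq_abs]
      gcongr
    have n2 : ‖s‖ ≤ (2 + ‖s‖) ^ 2 := by nlinarith [norm_nonneg s]
    have n3 : ‖s‖ * (‖s‖ + 1) ≤ (2 + ‖s‖) ^ 2 := by nlinarith [norm_nonneg s]
    calc (s.re - 1 / 2) * ‖(κ : ℂ) * s + s * (s - 1) * H s‖
        ≤ (s.re - 1 / 2) * (|κ| * ‖s‖ + ‖s‖ * (‖s‖ + 1) * ‖H s‖) := by gcongr
      _ = (s.re - 1 / 2) * (|κ| * ‖s‖) + ‖s‖ * (‖s‖ + 1) * ((s.re - 1 / 2) * ‖H s‖) := by ring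
      _ ≤ 3 * (|κ| * (2 + ‖s‖) ^ 2) + (2 + ‖s‖) ^ 2 * M := by
        gcongr
        linarith
      _ = _ := by ring
  rw [heq h1, hF]
  simp only
  rw [norm_mul, norm_mul]
  calc (s.re - 1 / 2) * (‖(c : ℂ) ^ s‖ * ‖Gamma (s + 1)‖ * ‖(κ : ℂ) * s + s * (s - 1) * H s‖)
      = ‖(c : ℂ) ^ s‖ * ‖Gamma (s + 1)‖ *
        ((s.re - 1 / 2) * ‖(κ : ℂ) * s + s * (s - 1) * H s‖) := by ring
    _ ≤ (1 + c) ^ (3 : ℝ) * B * ((3 * |κ| + M) * (2 + ‖s‖) ^ 2) := by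
      have := h.pos
      gcongr
    _ = _ := by ring

theorem IsXi.exists_sub_half_mul_norm_le (h : IsXi Z c ξ) (hZ : ZetaProperties Z) :
    ∃ B : ℝ, 0 ≤ B ∧ ∀ s : ℂ, -2 ≤ s.re → s.re ≤ 3 →
      |s.re - 1 / 2| * ‖ξ s‖ ≤ B * (3 + ‖s‖) ^ 2 := by
  obtain ⟨B, hB0, hB⟩ := h.exists_sub_half_mul_norm_le_right hZ
  refine ⟨B, hB0, fun s h1 h2 => ?_⟩
  rcases lt_trichotomy s.re (1 / 2) with hs | hs | hs
  · have := hB (1 - s) (by simp; linarith) (by simp; linarith)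
    rw [h.one_sub] at this
    have hn : ‖1 - s‖ ≤ 1 + ‖s‖ := by simpa using norm_sub_le 1 s
    have e : |s.re - 1 / 2| = (1 - s).re - 1 / 2 := by
      rw [abs_of_neg (by linarith)]; simp; ring
    rw [e]
    refine this.trans ?_
    gcongr B * ?_ ^ 2
    linarith
  · rw [hs]
    simp only [sub_self, abs_zero, zero_mul]
    positivity
  · rw [abs_of_pos (by linarith)]
    refine (hB s hs h2).trans ?_
    gcongr
    norm_num

/-- On the circle `‖u‖ = r` the polynomial `u² + r²` has norm `2r|Re u|`. -/
theorem Complex.norm_sq_add_sq_of_norm_eq {u : ℂ} {r : ℝ} (hu : ‖u‖ = r) :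
    ‖u ^ 2 + (r : ℂ) ^ 2‖ = 2 * r * |u.re| := by
  have : u ^ 2 + (r : ℂ) ^ 2 = u * ((2 * u.re : ℝ) : ℂ) := by
    rw [← hu, ← mul_conj', ← add_conj]
    ring
  rw [this, norm_mul, hu, norm_real, Real.norm_eq_abs, abs_mul, abs_two]
  ring

theorem IsXi.exists_norm_le (h : IsXi Z c ξ) (hZ : ZetaProperties Z) :
    ∃ B : ℝ, 0 ≤ B ∧ ∀ s : ℂ, 0 ≤ s.re → s.re ≤ 2 → ‖ξ s‖ ≤ B * (7 + ‖s‖) ^ 2 := by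
  obtain ⟨B, hB0, hB⟩ := h.exists_sub_half_mul_norm_le hZ
  refine ⟨B, hB0, fun s h0 h2 => ?_⟩
  set w : ℂ := 1 / 2 + s.im * I with hw
  have hsw : s - w = ((s.re - 1 / 2 : ℝ) : ℂ) := by
    apply Complex.ext <;> simp [hw]
  have hnsw : ‖s - w‖ ≤ 3 / 2 := by
    rw [hsw, norm_real, Real.norm_eq_abs, abs_le]
    constructor <;> linarith
  set f : ℂ → ℂ := fun z => ξ z * ((z - w) ^ 2 + ((2 : ℝ) : ℂ) ^ 2) with hf
  have hfd : Differentiable ℂ f := h.differentiable.mul (by fun_prop)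
  have key : ‖f s‖ ≤ 4 * B * (7 + ‖s‖) ^ 2 := by
    refine norm_le_of_forall_mem_frontier_norm_le (Metric.isBounded_ball (x := w) (r := 2))
      hfd.diffContOnCl (fun z hz => ?_) (subset_closure (by
        rw [Metric.mem_ball, dist_eq_norm]; linarith))
    rw [frontier_ball w two_ne_zero, mem_sphere_iff_norm] at hz
    have hre : (z - w).re = z.re - 1 / 2 := by simp [hw]
    have habs := abs_re_le_norm (z - w)
    rw [hz, hre, abs_le] at habs
    have hb := hB z (by linarith) (by linarith)
    have hzs : ‖z‖ ≤ ‖s‖ + 4 := by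
      have : ‖z‖ ≤ ‖z - w‖ + ‖s - w‖ + ‖s‖ := by
        have e : z = (z - w) - (s - w) + s := by ring
        calc ‖z‖ = ‖(z - w) - (s - w) + s‖ := by rw [← e]
          _ ≤ _ := (norm_add_le _ _).trans (by gcongr; exact norm_sub_le _ _)
      linarith
    rw [hf]
    simp only
    rw [norm_mul, norm_sq_add_sq_of_norm_eq hz, hre]
    calc ‖ξ z‖ * (2 * 2 * |z.re - 1 / 2|) = 4 * (|z.re - 1 / 2| * ‖ξ z‖) := by ring
      _ ≤ 4 * (B * (3 + ‖z‖) ^ 2) := by gcongr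
      _ ≤ 4 * (B * (7 + ‖s‖) ^ 2) := by
        gcongr 4 * (B * ?_ ^ 2)
        linarith
      _ = _ := by ring
  have h4 : 4 ≤ ‖(s - w) ^ 2 + ((2 : ℝ) : ℂ) ^ 2‖ := by
    rw [hsw, ← ofReal_pow, ← ofReal_pow, ← ofReal_add, norm_real, Real.norm_eq_abs]
    refine le_trans ?_ (le_abs_self _)
    nlinarith [sq_nonneg (s.re - 1 / 2)]
  rw [hf] at key
  simp only at key
  rw [norm_mul] at key
  nlinarith [norm_nonneg (ξ s)]

end Growth

section Ratio

/-- The scattering-type quotient `a^{-2z} ξ(z) / ξ(1 + z)`. -/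
noncomputable def xiRatio (ξ : ℂ → ℂ) (a : ℝ) (z : ℂ) : ℂ :=
  (a : ℂ) ^ (-2 * z) * ξ z / ξ (1 + z)

variable {Z : ℂ → ℂ} {c : ℝ} {ξ : ℂ → ℂ} {a : ℝ}

theorem IsXi.differentiableAt_xiRatio (h : IsXi Z c ξ) (hZ : ZetaProperties Z) (ha : 1 ≤ a)
    {z : ℂ} (hz : 0 ≤ z.re) : DifferentiableAt ℂ (xiRatio ξ a) z := by
  have ha0 : (a : ℂ) ≠ 0 := by
    have : a ≠ 0 := by linarith
    exact_mod_cast this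
  have h1 : DifferentiableAt ℂ (fun z : ℂ => (a : ℂ) ^ (-2 * z)) z :=
    DifferentiableAt.const_cpow (by fun_prop) (Or.inl ha0)
  have h2 : DifferentiableAt ℂ (fun z : ℂ => ξ (1 + z)) z :=
    DifferentiableAt.comp (g := ξ) (f := fun z : ℂ => 1 + z) z (h.differentiable _) (by fun_prop)
  exact (h1.mul (h.differentiable z)).div h2 (h.ne_zero hZ (by simpa using hz))

theorem norm_cpow_neg_two_mul (ha : 1 ≤ a) (z : ℂ) :
    ‖(a : ℂ) ^ (-2 * z)‖ = a ^ (-2 * z.re) := by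
  rw [norm_cpow_eq_rpow_re_of_pos (by linarith)]
  simp

theorem norm_cpow_neg_two_mul_le_one (ha : 1 ≤ a) {z : ℂ} (hz : 0 ≤ z.re) :
    ‖(a : ℂ) ^ (-2 * z)‖ ≤ 1 := by
  rw [norm_cpow_neg_two_mul ha]
  exact Real.rpow_le_one_of_one_le_of_nonpos ha (by linarith)

theorem IsXi.norm_xiRatio_of_re_eq_zero (h : IsXi Z c ξ) (hZ : ZetaProperties Z) (ha : 1 ≤ a)
    {z : ℂ} (hz : z.re = 0) : ‖xiRatio ξ a z‖ = 1 := by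
  have hconj : 1 - z = starRingEnd ℂ (1 + z) := by
    apply Complex.ext <;> simp [hz]
  have hnorm : ‖ξ z‖ = ‖ξ (1 + z)‖ := by
    rw [← h.one_sub, hconj, h.apply_conj hZ, norm_conj]
  have hne : ‖ξ (1 + z)‖ ≠ 0 := norm_ne_zero_iff.2 (h.ne_zero hZ (by simp [hz]))
  rw [xiRatio, norm_div, norm_mul, norm_cpow_neg_two_mul ha, hz, hnorm]
  simp [hne]

theorem IsXi.xiRatio_conj (h : IsXi Z c ξ) (hZ : ZetaProperties Z) (ha : 1 ≤ a) (z : ℂ) :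
    xiRatio ξ a (starRingEnd ℂ z) = starRingEnd ℂ (xiRatio ξ a z) := by
  have h1 : 1 + starRingEnd ℂ z = starRingEnd ℂ (1 + z) := by simp
  have h2 : -2 * starRingEnd ℂ z = starRingEnd ℂ (-2 * z) := by
    rw [map_mul, map_neg, conj_ofNat]
  rw [xiRatio, xiRatio, h1, h2, h.apply_conj hZ, h.apply_conj hZ,
    cpow_conj _ _ (by rw [arg_ofReal_of_nonneg (by linarith)]; exact Real.pi_ne_zero.symm),
    conj_ofReal, map_div₀, map_mul]

theorem ZetaProperties.norm_inv_le (hZ : ZetaProperties Z) {s : ℂ} (hs : 1 < s.re) :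
    ‖(Z s)⁻¹‖ ≤ ‖Z s.re‖ := by
  have h1 := hZ.one_le_norm_mul_norm s hs
  have hpos : 0 < ‖Z s‖ := by
    by_contra! h0
    nlinarith [norm_nonneg (Z s), norm_nonneg (Z (s.re : ℂ))]
  rw [norm_inv, inv_le_iff_one_le_mul₀' hpos]
  exact h1

theorem IsXi.exists_norm_xiRatio_mul_le (h : IsXi Z c ξ) (hZ : ZetaProperties Z) (ha : 1 ≤ a) :
    ∃ C : ℝ, 0 ≤ C ∧ ∀ z : ℂ, 3 / 2 ≤ z.re → ‖xiRatio ξ a z‖ * ‖z‖ ≤ C := by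
  refine ⟨‖Z (3 / 2 : ℝ)‖ * ‖Z (3 / 2 : ℝ)‖ / c, by have := h.pos; positivity, fun z hz => ?_⟩
  have hc : (c : ℂ) ≠ 0 := by exact_mod_cast h.pos.ne'
  have hz0 : z ≠ 0 := by rintro rfl; norm_num at hz
  have hz1 : 1 + z ≠ 0 := by
    intro h0
    have := congrArg re h0
    simp at this
    linarith
  have hΓ : Gamma z ≠ 0 := Gamma_ne_zero_of_re_pos (by linarith)
  have hcz : (c : ℂ) ^ z ≠ 0 := by simp [cpow_eq_zero_iff, hc]
  have hre1 : (1 + z).re = 1 + z.re := by simp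
  have heq : xiRatio ξ a z * z =
      (a : ℂ) ^ (-2 * z) * ((z - 1) * (1 + z)⁻¹) * (Z z * (Z (1 + z))⁻¹) * (c : ℂ)⁻¹ := by
    rw [xiRatio, h.eq_of_one_lt_re z (by linarith), h.eq_of_one_lt_re (1 + z) (by linarith),
      cpow_add _ _ hc, cpow_one, add_comm 1 z, Gamma_add_one z hz0, add_sub_cancel_right]
    rw [add_comm] at hz1
    by_cases hZ0 : Z (z + 1) = 0
    · simp [hZ0]
    field_simp
  have hq : ‖(z - 1) * (1 + z)⁻¹‖ ≤ 1 := by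
    rw [norm_mul, norm_inv, ← div_eq_mul_inv, div_le_one (norm_pos_iff.2 hz1)]
    refine abs_le_of_sq_le_sq' ?_ (norm_nonneg _) |>.2
    rw [← normSq_eq_norm_sq, ← normSq_eq_norm_sq, normSq_apply, normSq_apply]
    simp
    nlinarith
  have h1 := hZ.norm_le_of_le z (3 / 2) (by norm_num) hz
  have h2 := (hZ.norm_inv_le (s := 1 + z) (by linarith)).trans
    (hZ.norm_le_of_le _ (3 / 2) (by norm_num) (by simp; linarith))
  have h3 := norm_cpow_neg_two_mul_le_one ha (z := z) (by linarith)
  rw [← norm_mul, heq, norm_mul, norm_mul, norm_mul, norm_mul (Z z), norm_inv (c : ℂ), norm_real,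
    Real.norm_of_nonneg h.pos.le, div_eq_mul_inv]
  have := h.pos
  calc _ ≤ 1 * 1 * (‖Z (3 / 2 : ℝ)‖ * ‖Z (3 / 2 : ℝ)‖) * c⁻¹ := by gcongr
    _ = _ := by rw [one_mul, one_mul]

theorem ZetaProperties.exists_sub_one_mul_norm_le (hZ : ZetaProperties Z) :
    ∃ C : ℝ, 0 ≤ C ∧ ∀ x : ℝ, 0 < x → x ≤ 2 → x * ‖Z (1 + x)‖ ≤ C := by
  obtain ⟨κ, H, M, hM, -, hHb, hZH⟩ := hZ.continuation
  refine ⟨3 * |κ| + 12 * M, by positivity, fun x hx hx2 => ?_⟩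
  have hre : (1 + x : ℂ).re = 1 + x := by simp
  have hH : ‖H (1 + x)‖ ≤ 2 * M := by
    refine (hHb (1 + x) (by rw [hre]; linarith)).trans ?_
    rw [hre, div_le_iff₀ (by linarith)]
    nlinarith
  have hxc : (x : ℂ) ≠ 0 := by exact_mod_cast hx.ne'
  have heq : (x : ℂ) * Z (1 + x) = κ * (1 + x : ℝ) + x * (1 + x : ℝ) * H (1 + x) := by
    rw [hZH (1 + x) (by rw [hre]; linarith), add_sub_cancel_left]
    push_cast
    field_simp
  have : x * ‖Z (1 + x)‖ = ‖(x : ℂ) * Z (1 + x)‖ := by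
    rw [norm_mul, norm_real, Real.norm_of_nonneg hx.le]
  rw [this, heq]
  refine (norm_add_le _ _).trans ?_
  rw [norm_mul, norm_mul, norm_mul, norm_real, norm_real, norm_real, Real.norm_of_nonneg hx.le,
    Real.norm_of_nonneg (by linarith : 0 ≤ 1 + x), Real.norm_eq_abs]
  calc |κ| * (1 + x) + x * (1 + x) * ‖H (1 + x)‖ ≤ |κ| * (1 + 2) + 2 * (1 + 2) * (2 * M) := by
        gcongr
    _ = _ := by ring

theorem IsXi.exists_sq_mul_norm_xiRatio_le (h : IsXi Z c ξ) (hZ : ZetaProperties Z)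
    (ha : 1 ≤ a) :
    ∃ C : ℝ, 0 ≤ C ∧ ∀ z : ℂ, 0 < z.re → z.re ≤ 2 →
      z.re ^ 2 * ‖xiRatio ξ a z‖ ≤ C * Real.exp (6 * ‖z‖) := by
  obtain ⟨B, hB0, hB⟩ := h.exists_norm_le hZ
  obtain ⟨B', hB'0, hB'⟩ := exists_norm_inv_Gamma_le
  obtain ⟨C, hC0, hC⟩ := hZ.exists_sub_one_mul_norm_le
  have hcpos := h.pos
  have hc : (c : ℂ) ≠ 0 := by exact_mod_cast h.pos.ne'
  refine ⟨B * 49 * ((1 + c⁻¹) ^ (3 : ℝ) * B' * Real.exp 4) * C, by positivity,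
    fun z hz hz2 => ?_⟩
  have hz0 : z ≠ 0 := by rintro rfl; norm_num at hz
  have hre1 : (1 + z).re = 1 + z.re := by simp
  have hz1 : 1 ≤ ‖1 + z‖ := by
    have := (le_abs_self _).trans (abs_re_le_norm (1 + z))
    linarith
  have n1 : ‖ξ z‖ ≤ B * 49 * Real.exp (2 * ‖z‖) := by
    refine (hB z hz.le hz2).trans ?_
    have e1 : 7 + ‖z‖ ≤ 7 * Real.exp ‖z‖ := by
      linarith [Real.add_one_le_exp ‖z‖, norm_nonneg z]
    calc B * (7 + ‖z‖) ^ 2 ≤ B * (7 * Real.exp ‖z‖) ^ 2 := by gcongr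
      _ = B * 49 * Real.exp (2 * ‖z‖) := by rw [mul_pow, ← Real.exp_nat_mul]; norm_num; ring
  have n2 : ‖((c : ℂ) ^ (1 + z))⁻¹‖ ≤ (1 + c⁻¹) ^ (3 : ℝ) := by
    rw [norm_inv, norm_cpow_eq_rpow_re_of_pos hcpos, ← Real.inv_rpow hcpos.le, hre1]
    have : 0 < c⁻¹ := by positivity
    calc c⁻¹ ^ (1 + z.re) ≤ (1 + c⁻¹) ^ (1 + z.re) :=
          Real.rpow_le_rpow this.le (by linarith) (by linarith)
      _ ≤ _ := Real.rpow_le_rpow_of_exponent_le (by linarith) (by linarith)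
  have n3 : ‖(Gamma (1 + z))⁻¹‖ ≤ B' * (Real.exp 4 * Real.exp (4 * ‖z‖)) := by
    refine (hB' (1 + z) (by linarith) (by linarith)).trans ?_
    rw [← Real.exp_add]
    gcongr
    have : ‖1 + z‖ ≤ 1 + ‖z‖ := by simpa using norm_add_le 1 z
    nlinarith [Real.pi_le_four, norm_nonneg (1 + z)]
  have n4 : z.re * ‖(Z (1 + z))⁻¹‖ ≤ C := by
    refine le_trans ?_ (hC z.re hz hz2)
    gcongr
    have := hZ.norm_inv_le (s := 1 + z) (by linarith)
    rw [hre1] at this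
    simpa using this
  have n5 : z.re * ‖z⁻¹‖ ≤ 1 := by
    rw [norm_inv, ← div_eq_mul_inv]
    exact div_le_one_of_le₀ ((le_abs_self _).trans (abs_re_le_norm z)) (norm_nonneg z)
  have n6 : ‖(1 + z)⁻¹‖ ≤ 1 := by
    rw [norm_inv]
    exact inv_le_one_of_one_le₀ hz1
  have n7 := norm_cpow_neg_two_mul_le_one ha hz.le
  have heq : xiRatio ξ a z = (a : ℂ) ^ (-2 * z) * ξ z * ((1 + z)⁻¹ * z⁻¹ *
      (((c : ℂ) ^ (1 + z))⁻¹ * (Gamma (1 + z))⁻¹ * (Z (1 + z))⁻¹)) := by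
    rw [xiRatio, h.eq_of_one_lt_re (1 + z) (by linarith), add_sub_cancel_left, div_eq_mul_inv,
      mul_inv, mul_inv, mul_inv, mul_inv]
  rw [heq]
  simp only [norm_mul]
  calc _ = ‖(a : ℂ) ^ (-2 * z)‖ * ‖ξ z‖ * (‖(1 + z)⁻¹‖ * (z.re * ‖z⁻¹‖) *
        (‖((c : ℂ) ^ (1 + z))⁻¹‖ * ‖(Gamma (1 + z))⁻¹‖ * (z.re * ‖(Z (1 + z))⁻¹‖))) := by ring
    _ ≤ 1 * (B * 49 * Real.exp (2 * ‖z‖)) * (1 * 1 *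
        ((1 + c⁻¹) ^ (3 : ℝ) * (B' * (Real.exp 4 * Real.exp (4 * ‖z‖))) * C)) := by
      gcongr
    _ = B * 49 * ((1 + c⁻¹) ^ (3 : ℝ) * B' * Real.exp 4) * C *
        (Real.exp (2 * ‖z‖) * Real.exp (4 * ‖z‖)) := by ring
    _ = _ := by
      rw [← Real.exp_add]
      ring_nf

theorem IsXi.exists_norm_xiRatio_le_exp (h : IsXi Z c ξ) (hZ : ZetaProperties Z) (ha : 1 ≤ a) :
    ∃ C : ℝ, 0 ≤ C ∧ ∀ z : ℂ, 0 < z.re → ‖xiRatio ξ a z‖ ≤ C * Real.exp (6 * ‖z‖) := by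
  obtain ⟨C, hC0, hC⟩ := h.exists_sq_mul_norm_xiRatio_le hZ ha
  obtain ⟨D, hD0, hD⟩ := h.exists_norm_xiRatio_mul_le hZ ha
  refine ⟨4 + 4 * C * Real.exp 6 + D, by positivity, fun z hz => ?_⟩
  have hexp : 1 ≤ Real.exp (6 * ‖z‖) := Real.one_le_exp (by positivity)
  have hexp6 : 1 ≤ Real.exp 6 := Real.one_le_exp (by norm_num)
  rcases le_total z.re (1 / 2) with hsmall | hlarge
  · set w : ℂ := z.im * I with hw
    set f : ℂ → ℂ := fun p => xiRatio ξ a p * ((p - w) ^ 2 + ((1 : ℝ) : ℂ) ^ 2) ^ 2 with hf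
    have hzw : z - w = (z.re : ℂ) := by apply Complex.ext <;> simp [hw]
    have hwz : ‖w‖ ≤ ‖z‖ := by
      rw [hw, norm_mul, norm_I, mul_one, norm_real]
      exact abs_im_le_norm z
    have hzU : z ∈ Metric.ball w 1 ∩ {p : ℂ | 0 < p.re} := by
      refine ⟨?_, hz⟩
      rw [Metric.mem_ball, dist_eq_norm, hzw, norm_real, Real.norm_of_nonneg hz.le]
      linarith
    have hcl : closure (Metric.ball w 1 ∩ {p : ℂ | 0 < p.re}) ⊆
        Metric.closedBall w 1 ∩ {p : ℂ | 0 ≤ p.re} := by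
      refine closure_minimal (Set.inter_subset_inter Metric.ball_subset_closedBall ?_)
        (Metric.isClosed_closedBall.inter (isClosed_le continuous_const continuous_re))
      intro p hp
      exact le_of_lt (show (0 : ℝ) < p.re from hp)
    have hfd : ∀ p : ℂ, 0 ≤ p.re → DifferentiableAt ℂ f p := fun p hp =>
      (h.differentiableAt_xiRatio hZ ha hp).mul (by fun_prop)
    have hdc : DiffContOnCl ℂ f (Metric.ball w 1 ∩ {p : ℂ | 0 < p.re}) :=
      DifferentiableOn.diffContOnCl fun p hp => (hfd p (hcl hp).2).differentiableWithinAt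
    have key : ‖f z‖ ≤ 4 + 4 * C * Real.exp 6 * Real.exp (6 * ‖z‖) := by
      refine norm_le_of_forall_mem_frontier_norm_le (Metric.isBounded_ball.subset
        Set.inter_subset_left) hdc (fun p hp => ?_) (subset_closure hzU)
      have hpc := hcl (frontier_subset_closure hp)
      have hp0 : 0 ≤ p.re := hpc.2
      have hp1 : ‖p - w‖ ≤ 1 := by simpa [dist_eq_norm] using hpc.1
      rw [hf]
      simp only
      rw [norm_mul, norm_pow]
      rcases hp0.eq_or_lt with hp0 | hp0
      · rw [h.norm_xiRatio_of_re_eq_zero hZ ha hp0.symm, one_mul]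
        have : ‖(p - w) ^ 2 + ((1 : ℝ) : ℂ) ^ 2‖ ≤ 2 := by
          refine (norm_add_le _ _).trans ?_
          rw [norm_pow, norm_pow]
          simp only [ofReal_one, norm_one, one_pow]
          nlinarith [norm_nonneg (p - w)]
        have h0 := norm_nonneg ((p - w) ^ 2 + ((1 : ℝ) : ℂ) ^ 2)
        have : 0 ≤ 4 * C * Real.exp 6 * Real.exp (6 * ‖z‖) := by positivity
        nlinarith
      · have hps : ‖p - w‖ = 1 := by
          refine le_antisymm hp1 (not_lt.1 fun hlt => ?_)
          have ho : IsOpen (Metric.ball w 1 ∩ {p : ℂ | 0 < p.re}) :=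
            Metric.isOpen_ball.inter (isOpen_lt continuous_const continuous_re)
          rw [ho.frontier_eq] at hp
          exact hp.2 ⟨by simpa [dist_eq_norm] using hlt, hp0⟩
        have hpre : (p - w).re = p.re := by simp [hw]
        have hp2 : p.re ≤ 2 := by
          have := (le_abs_self _).trans (abs_re_le_norm (p - w))
          linarith
        have hpz : ‖p‖ ≤ 1 + ‖z‖ := by
          have := norm_add_le (p - w) w
          rw [sub_add_cancel] at this
          linarith
        rw [norm_sq_add_sq_of_norm_eq hps, hpre, abs_of_pos hp0]
        calc ‖xiRatio ξ a p‖ * (2 * 1 * p.re) ^ 2 = 4 * (p.re ^ 2 * ‖xiRatio ξ a p‖) := by ring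
          _ ≤ 4 * (C * Real.exp (6 * ‖p‖)) := by linarith [hC p hp0 hp2]
          _ ≤ 4 * (C * Real.exp (6 * (1 + ‖z‖))) := by gcongr
          _ = 4 * C * Real.exp 6 * Real.exp (6 * ‖z‖) := by
            rw [mul_add, Real.exp_add]
            ring_nf
          _ ≤ _ := by linarith
    have h1 : 1 ≤ ‖((z - w) ^ 2 + ((1 : ℝ) : ℂ) ^ 2) ^ 2‖ := by
      rw [hzw, ← ofReal_pow, ← ofReal_pow, ← ofReal_add, norm_pow, norm_real, Real.norm_eq_abs]
      refine one_le_pow₀ (le_trans ?_ (le_abs_self _))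
      nlinarith [sq_nonneg z.re]
    rw [hf] at key
    simp only at key
    rw [norm_mul] at key
    have := (le_mul_of_one_le_right (norm_nonneg (xiRatio ξ a z)) h1).trans key
    nlinarith
  rcases le_total z.re 2 with h2 | h2
  · have := hC z hz h2
    have hsq : 1 / 4 ≤ z.re ^ 2 := by nlinarith
    have h3 : ‖xiRatio ξ a z‖ ≤ 4 * (C * Real.exp (6 * ‖z‖)) := by
      nlinarith [norm_nonneg (xiRatio ξ a z)]
    refine h3.trans ?_
    have : C * Real.exp (6 * ‖z‖) ≤ C * Real.exp (6 * ‖z‖) * Real.exp 6 :=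
      le_mul_of_one_le_right (by positivity) hexp6
    nlinarith
  · have := hD z (by linarith)
    have hn : 1 ≤ ‖z‖ := by
      have := (le_abs_self _).trans (abs_re_le_norm z)
      linarith
    have h3 : ‖xiRatio ξ a z‖ ≤ D :=
      (le_mul_of_one_le_right (norm_nonneg _) hn).trans this
    have : 0 ≤ C * Real.exp 6 := by positivity
    nlinarith

theorem IsXi.norm_xiRatio_le_one (h : IsXi Z c ξ) (hZ : ZetaProperties Z) (ha : 1 ≤ a) {z : ℂ}
    (hz : 0 ≤ z.re) : ‖xiRatio ξ a z‖ ≤ 1 := by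
  obtain ⟨C, hC0, hC⟩ := h.exists_norm_xiRatio_le_exp hZ ha
  obtain ⟨D, hD0, hD⟩ := h.exists_norm_xiRatio_mul_le hZ ha
  refine PhragmenLindelof.right_half_plane_of_bounded_on_real ?_ ⟨1, one_lt_two, 6, ?_⟩ ?_
    (fun x => (h.norm_xiRatio_of_re_eq_zero hZ ha (by simp)).le) hz
  · refine DifferentiableOn.diffContOnCl fun p hp => ?_
    have : p.re ∈ Set.Ici 0 := by simpa [closure_setOfPred_lt_re] using hp
    exact (h.differentiableAt_xiRatio hZ ha this).differentiableWithinAt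
  · refine Asymptotics.IsBigO.of_bound C ?_
    filter_upwards [mem_inf_of_right (mem_principal_self _)] with p hp
    have := hC p hp
    rwa [Real.norm_of_nonneg (Real.exp_pos _).le, Real.rpow_one]
  · refine ⟨D, ?_⟩
    rw [eventually_map]
    filter_upwards [eventually_ge_atTop (3 / 2)] with x hx
    have h1 := hD x (by simpa using hx)
    refine le_trans (le_mul_of_one_le_right (norm_nonneg _) ?_) h1
    rw [norm_real]
    exact le_trans (by linarith) (le_abs_self x)

theorem IsXi.tendsto_xiRatio_atTop (h : IsXi Z c ξ) (hZ : ZetaProperties Z) (ha : 1 ≤ a) :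
    Tendsto (fun x : ℝ => xiRatio ξ a x) atTop (𝓝 0) := by
  obtain ⟨D, hD0, hD⟩ := h.exists_norm_xiRatio_mul_le hZ ha
  refine squeeze_zero_norm' ?_ (tendsto_const_nhds.div_atTop (a := D) tendsto_id)
  filter_upwards [eventually_ge_atTop (3 / 2)] with x hx
  have h1 := hD x (by simpa using hx)
  rw [norm_real, Real.norm_of_nonneg (by linarith)] at h1
  rwa [id, le_div_iff₀ (by linarith)]

end Ratio

section RealSchur

/-- A function analytic on the closed right half plane, bounded by one there, real on the positive
real axis and tending to zero along it. -/
structure IsRealSchur (Θ : ℂ → ℂ) : Prop where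
  analyticAt : ∀ z : ℂ, 0 ≤ z.re → AnalyticAt ℂ Θ z
  norm_le_one : ∀ z : ℂ, 0 ≤ z.re → ‖Θ z‖ ≤ 1
  conj : ∀ z : ℂ, Θ (starRingEnd ℂ z) = starRingEnd ℂ (Θ z)
  tendsto_atTop : Tendsto (fun x : ℝ => Θ x) atTop (𝓝 0)

variable {Θ : ℂ → ℂ}

theorem IsRealSchur.norm_lt_one (h : IsRealSchur Θ) {z : ℂ} (hz : 0 < z.re) : ‖Θ z‖ < 1 := by
  refine (h.norm_le_one z hz.le).lt_of_ne fun h1 => ?_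
  have hconst := eqOn_of_isPreconnected_of_isMaxOn_norm (f := Θ) (U := {z : ℂ | 0 < z.re}) (c := z)
    (convex_halfSpace_re_gt _).isPreconnected (isOpen_lt continuous_const continuous_re)
    (fun w hw => (h.analyticAt w (le_of_lt hw)).differentiableAt.differentiableWithinAt) hz
    (fun w hw => by
      simp only [Function.comp_apply, h1]
      exact h.norm_le_one w (le_of_lt hw))
  have hlim : Tendsto (fun x : ℝ => Θ x) atTop (𝓝 (Θ z)) := by
    refine tendsto_const_nhds.congr' ?_
    filter_upwards [eventually_gt_atTop 0] with x hx
    exact (hconst (show (0 : ℝ) < (x : ℂ).re by simpa using hx)).symm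
  rw [tendsto_nhds_unique hlim h.tendsto_atTop, norm_zero] at h1
  exact zero_ne_one h1

/-- The Schwarz-Pick inequality on the right half plane between a point and a positive real. -/
theorem IsRealSchur.norm_sub_mul_norm_add_le (h : IsRealSchur Θ) {x : ℝ} (hx : 0 < x) {z : ℂ}
    (hz : 0 < z.re) :
    ‖Θ z - Θ x‖ * ‖z + x‖ ≤ ‖z - x‖ * ‖1 - Θ x * Θ z‖ := by
  have hθ := h.norm_lt_one (z := x) (by simpa using hx)
  have hθc : starRingEnd ℂ (Θ x) = Θ x := by rw [← h.conj, conj_ofReal]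
  set θ := Θ x with hθdef
  have hne : ∀ w : ℂ, ‖w‖ ≤ 1 → 1 - θ * w ≠ 0 := fun w hw h0 => by
    have : ‖θ * w‖ = 1 := by rw [← sub_eq_zero.1 h0, norm_one]
    rw [norm_mul] at this
    nlinarith [norm_nonneg w, norm_nonneg θ]
  have hb : ∀ w : ℂ, ‖w‖ ≤ 1 → ‖(w - θ) / (1 - θ * w)‖ ≤ 1 := fun w hw => by
    rw [norm_div, div_le_one (norm_pos_iff.2 (hne w hw))]
    refine (abs_le_of_sq_le_sq' ?_ (norm_nonneg _)).2
    have him : θ.im = 0 := conj_eq_iff_im.1 hθc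
    have hθ1 : θ.re ^ 2 ≤ 1 := by
      have : normSq θ ≤ 1 := by
        rw [normSq_eq_norm_sq]; nlinarith [norm_nonneg θ]
      rw [normSq_apply, him] at this
      nlinarith
    have hw1 : w.re ^ 2 + w.im ^ 2 ≤ 1 := by
      have : normSq w ≤ 1 := by
        rw [normSq_eq_norm_sq]; nlinarith [norm_nonneg w]
      rw [normSq_apply] at this
      nlinarith
    rw [← normSq_eq_norm_sq, ← normSq_eq_norm_sq, normSq_apply, normSq_apply]
    simp only [sub_re, sub_im, one_re, one_im, mul_re, mul_im, him]
    nlinarith [mul_nonneg (sub_nonneg.2 hθ1) (sub_nonneg.2 hw1)]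
  set C : ℂ → ℂ := fun w => x * (1 + w) / (1 - w) with hC
  have hden : ∀ w : ℂ, ‖w‖ < 1 → 1 - w ≠ 0 := fun w hw h0 => by
    rw [← sub_eq_zero.1 h0, norm_one] at hw
    exact lt_irrefl _ hw
  have hCre : ∀ w : ℂ, ‖w‖ < 1 → 0 < (C w).re := fun w hw => by
    have hpos : 0 < normSq (1 - w) := normSq_pos.2 (hden w hw)
    have hw1 : w.re ^ 2 + w.im ^ 2 < 1 := by
      have : normSq w < 1 := by
        rw [normSq_eq_norm_sq]; nlinarith [norm_nonneg w]
      rw [normSq_apply] at this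
      nlinarith
    rw [hC]
    simp only
    rw [div_re, ← add_div]
    refine div_pos ?_ hpos
    simp
    nlinarith
  set f : ℂ → ℂ := fun w => (Θ (C w) - θ) / (1 - θ * Θ (C w)) with hf
  have hCd : ∀ w : ℂ, ‖w‖ < 1 → DifferentiableAt ℂ C w := fun w hw =>
    (by fun_prop : DifferentiableAt ℂ (fun w : ℂ => x * (1 + w)) w).div (by fun_prop) (hden w hw)
  have hfd : DifferentiableOn ℂ f (Metric.ball 0 1) := fun w hw => by
    have hw : ‖w‖ < 1 := by simpa using hw
    have h1 : DifferentiableAt ℂ (fun w => Θ (C w)) w := DifferentiableAt.comp (g := Θ) (f := C) w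
      (h.analyticAt _ (hCre w hw).le).differentiableAt (hCd w hw)
    exact ((h1.sub_const θ).div ((h1.const_mul θ).const_sub 1)
      (hne _ (h.norm_le_one _ (hCre w hw).le))).differentiableWithinAt
  have hfm : Set.MapsTo f (Metric.ball 0 1) (Metric.closedBall 0 1) := fun w hw => by
    have hw : ‖w‖ < 1 := by simpa using hw
    exact mem_closedBall_zero_iff.2 (hb _ (h.norm_le_one _ (hCre w hw).le))
  have hf0 : f 0 = 0 := by simp [hf, hC, hθdef]
  have hzx : z + x ≠ 0 := fun h0 => by
    have := congrArg re h0
    simp at this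
    linarith
  have hw : ‖(z - x) / (z + x)‖ < 1 := by
    rw [norm_div, div_lt_one (norm_pos_iff.2 hzx)]
    refine abs_lt_of_sq_lt_sq' ?_ (norm_nonneg _) |>.2
    rw [← normSq_eq_norm_sq, ← normSq_eq_norm_sq, normSq_apply, normSq_apply]
    simp
    nlinarith
  have hCz : C ((z - x) / (z + x)) = z := by
    have hx0 : (x : ℂ) ≠ 0 := by exact_mod_cast hx.ne'
    have h2 : 1 - (z - x) / (z + x) ≠ 0 := hden _ hw
    rw [hC]
    simp only
    rw [div_eq_iff h2]
    field_simp
    ring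
  have key := norm_le_norm_of_mapsTo_ball hfd hfm hf0 hw
  rw [hf] at key
  simp only [hCz] at key
  rw [norm_div, norm_div, div_le_div_iff₀ (norm_pos_iff.2 (hne _ (h.norm_le_one _ hz.le)))
    (norm_pos_iff.2 hzx)] at key
  exact key

theorem IsRealSchur.two_mul_abs_im_mul_re_le (h : IsRealSchur Θ) {z : ℂ} (hz : 0 < z.re) :
    2 * |(Θ z).im| * z.re ≤ |z.im| * (1 - ‖Θ z‖ ^ 2) := by
  have hz0 : z ≠ 0 := by rintro rfl; simp at hz
  set x : ℝ := ‖z‖ with hx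
  have hx0 : 0 < x := norm_pos_iff.2 hz0
  have hx2 : x ^ 2 = z.re ^ 2 + z.im ^ 2 := by
    rw [hx, ← normSq_eq_norm_sq, normSq_apply]; ring
  have hsp := h.norm_sub_mul_norm_add_le hx0 hz
  have him : (Θ x).im = 0 := by
    rw [← conj_eq_iff_im, ← h.conj, conj_ofReal]
  have hθ := h.norm_lt_one (z := x) (by simpa using hx0)
  set θ := (Θ x).re with hθdef
  have hθ1 : θ ^ 2 < 1 := by
    have : normSq (Θ x) < 1 := by
      rw [normSq_eq_norm_sq]; nlinarith [norm_nonneg (Θ x)]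
    rw [normSq_apply, him] at this
    nlinarith
  have hn : ‖Θ z‖ ^ 2 = (Θ z).re ^ 2 + (Θ z).im ^ 2 := by
    rw [← normSq_eq_norm_sq, normSq_apply]; ring
  have hn1 : ‖Θ z‖ ^ 2 ≤ 1 := by nlinarith [h.norm_le_one z hz.le, norm_nonneg (Θ z)]
  have hsq := pow_le_pow_left₀ (by positivity) hsp 2
  rw [mul_pow, mul_pow, ← normSq_eq_norm_sq, ← normSq_eq_norm_sq, ← normSq_eq_norm_sq,
    ← normSq_eq_norm_sq, normSq_apply, normSq_apply, normSq_apply, normSq_apply] at hsq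
  simp only [sub_re, sub_im, add_re, add_im, mul_re, mul_im, one_re, one_im, ofReal_re, ofReal_im,
    him, ← hθdef, zero_mul, sub_zero, add_zero] at hsq
  rw [hn] at hn1 ⊢
  set p := (Θ z).re
  set q := (Θ z).im
  set σ := z.re
  set τ := z.im
  have e1 : (σ + x) * (σ + x) + τ * τ = 2 * x * (x + σ) := by linear_combination -hx2
  have e2 : (σ - x) * (σ - x) + τ * τ = 2 * x * (x - σ) := by linear_combination -hx2
  rw [e1, e2] at hsq
  have h1 : σ * ((1 + θ ^ 2) * (1 + p ^ 2 + q ^ 2) - 4 * θ * p) ≤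
      x * ((1 - θ ^ 2) * (1 - (p ^ 2 + q ^ 2))) := by
    have : 2 * x * (σ * ((1 + θ ^ 2) * (1 + p ^ 2 + q ^ 2) - 4 * θ * p)) ≤
        2 * x * (x * ((1 - θ ^ 2) * (1 - (p ^ 2 + q ^ 2)))) := by
      linear_combination hsq
    exact le_of_mul_le_mul_left this (by positivity)
  set A := Real.sqrt ((1 - p) ^ 2 + q ^ 2) with hA
  set B := Real.sqrt ((1 + p) ^ 2 + q ^ 2) with hB
  have hA2 : A ^ 2 = (1 - p) ^ 2 + q ^ 2 := Real.sq_sqrt (by positivity)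
  have hB2 : B ^ 2 = (1 + p) ^ 2 + q ^ 2 := Real.sq_sqrt (by positivity)
  have h2 : (1 - θ ^ 2) * (A * B) ≤ (1 + θ ^ 2) * (1 + p ^ 2 + q ^ 2) - 4 * θ * p := by
    linear_combination (1 / 2) * sq_nonneg ((1 + θ) * A - (1 - θ) * B) + (1 + θ) ^ 2 / 2 * hA2 +
      (1 - θ) ^ 2 / 2 * hB2
  have h3 : σ * (A * B) ≤ x * (1 - (p ^ 2 + q ^ 2)) := by
    have : (1 - θ ^ 2) * (σ * (A * B)) ≤ (1 - θ ^ 2) * (x * (1 - (p ^ 2 + q ^ 2))) := by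
      nlinarith [mul_le_mul_of_nonneg_left h2 hz.le]
    exact le_of_mul_le_mul_left this (by linarith)
  have h4 : (σ * (A * B)) ^ 2 ≤ (x * (1 - (p ^ 2 + q ^ 2))) ^ 2 :=
    pow_le_pow_left₀ (by positivity) h3 2
  have h5 : (2 * |q| * σ) ^ 2 ≤ (|τ| * (1 - (p ^ 2 + q ^ 2))) ^ 2 := by
    rw [mul_pow, mul_pow, mul_pow, sq_abs, sq_abs]
    rw [mul_pow, mul_pow, mul_pow, hA2, hB2, hx2] at h4
    linear_combination h4
  exact (abs_le_of_sq_le_sq' h5 (by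
    have : 0 ≤ 1 - (p ^ 2 + q ^ 2) := by linarith
    positivity)).2

/-- For the function `N = (1 - Θ)/(1 + Θ)`, which has positive real part, `N(z)/z` has imaginary
part of sign opposite to that of `Im z`. -/
theorem IsRealSchur.im_mul_im_div_nonpos (h : IsRealSchur Θ) {z : ℂ} (hz : 0 < z.re) :
    z.im * ((1 - Θ z) / ((1 + Θ z) * z)).im ≤ 0 := by
  have key := h.two_mul_abs_im_mul_re_le hz
  have hn : ‖Θ z‖ ^ 2 = (Θ z).re ^ 2 + (Θ z).im ^ 2 := by
    rw [← normSq_eq_norm_sq, normSq_apply]; ring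
  rw [hn] at key
  rw [div_im, ← sub_div, ← mul_div_assoc]
  refine div_nonpos_of_nonpos_of_nonneg ?_ (normSq_nonneg _)
  simp only [sub_re, sub_im, add_re, add_im, mul_re, mul_im, one_re, one_im]
  have h1 := mul_le_mul_of_nonneg_left key (abs_nonneg z.im)
  have h2 : |z.im| * |z.im| = z.im ^ 2 := by rw [abs_mul_abs_self]; ring
  have h3 : -(z.im * (Θ z).im) ≤ |z.im| * |(Θ z).im| := by
    rw [← abs_mul]; exact neg_le_abs _
  nlinarith [mul_le_mul_of_nonneg_right h3 hz.le]

/-- If `g` maps a half disc at a zero `z₀` into a half plane bounded by a line through the origin,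
then `z₀` is a simple zero unless `g` vanishes identically near `z₀`. -/
theorem AnalyticAt.deriv_ne_zero_of_im_nonpos {g : ℂ → ℂ} {z₀ u c : ℂ} (hg : AnalyticAt ℂ g z₀)
    (hg0 : g z₀ = 0) (hne : ¬∀ᶠ z in 𝓝 z₀, g z = 0) (hu : u ≠ 0) (hc : c ≠ 0)
    (him : ∀ᶠ z in 𝓝 z₀, 0 < (u * (z - z₀)).im → (c * g z).im ≤ 0) : deriv g z₀ ≠ 0 := by
  intro hderiv
  obtain ⟨m, φ, hφ, hφ0, hev⟩ := hg.exists_eventuallyEq_pow_smul_nonzero_iff.2 hne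
  have hm : 2 ≤ m := by
    by_contra! hlt
    interval_cases m
    · have := hev.self_of_nhds
      simp [hg0] at this
      exact hφ0 this.symm
    · have hd : HasDerivAt (fun z => (z - z₀) ^ 1 • φ z) (φ z₀) z₀ := by
        have := ((hasDerivAt_id z₀).sub_const z₀).fun_mul hφ.differentiableAt.hasDerivAt
        simpa using this
      rw [EventuallyEq.deriv_eq hev, hd.deriv] at hderiv
      exact hφ0 hderiv
  set A : ℂ := c / u ^ m * φ z₀ with hA
  have hA0 : A ≠ 0 := mul_ne_zero (div_ne_zero hc (pow_ne_zero _ hu)) hφ0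
  have hkey : ∀ α : ℝ, 0 < α → α < Real.pi → (exp (α * I) ^ m * A).im ≤ 0 := by
    intro α h0 hπ
    set v : ℂ := exp (α * I) with hv
    have hray : Tendsto (fun t : ℝ => z₀ + t * (v / u)) (𝓝[>] 0) (𝓝 z₀) := by
      refine tendsto_nhdsWithin_of_tendsto_nhds ?_
      have : ContinuousAt (fun t : ℝ => z₀ + t * (v / u)) 0 := by fun_prop
      simpa [ContinuousAt] using this
    have hlim : Tendsto (fun t : ℝ => (v ^ m * (c / u ^ m * φ (z₀ + t * (v / u)))).im) (𝓝[>] 0)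
        (𝓝 (v ^ m * A).im) :=
      (continuous_im.tendsto _).comp
        (((hφ.continuousAt.tendsto.comp hray).const_mul _).const_mul _)
    refine le_of_tendsto hlim ?_
    filter_upwards [hray.eventually hev, hray.eventually him, self_mem_nhdsWithin] with t h1 h2 ht
    have ht : 0 < t := ht
    have hdir : u * (z₀ + t * (v / u) - z₀) = t * v := by field_simp; ring
    rw [hdir] at h2
    have hpos : 0 < ((t : ℂ) * v).im := by
      rw [im_ofReal_mul, hv, exp_ofReal_mul_I_im]
      exact mul_pos ht (Real.sin_pos_of_pos_of_lt_pi h0 hπ)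
    have h3 := h2 hpos
    have h4 : c * g (z₀ + t * (v / u)) =
        ((t ^ m : ℝ) : ℂ) * (v ^ m * (c / u ^ m * φ (z₀ + t * (v / u)))) := by
      rw [h1, smul_eq_mul, add_sub_cancel_left, mul_pow, div_pow]
      push_cast
      ring
    rw [h4, im_ofReal_mul] at h3
    exact nonpos_of_mul_nonpos_right h3 (pow_pos ht m)
  have hm0 : (0 : ℝ) < m := by exact_mod_cast (by omega : 0 < m)
  have hm2 : (2 : ℝ) ≤ m := by exact_mod_cast hm
  have hquarter : ∀ j : ℕ, j ≤ 3 → (I ^ j * (exp (Real.pi / 4 * I) * A)).im ≤ 0 := by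
    intro j hj
    have hj' : (j : ℝ) ≤ 3 := by exact_mod_cast hj
    have := hkey ((Real.pi / 4 + j * (Real.pi / 2)) / m) (by positivity) (by
      rw [div_lt_iff₀ hm0]
      nlinarith [Real.pi_pos])
    have e : exp (((Real.pi / 4 + j * (Real.pi / 2)) / m : ℝ) * I) ^ m =
        I ^ j * exp (Real.pi / 4 * I) := by
      have hmc : (m : ℂ) ≠ 0 := by exact_mod_cast hm0.ne'
      rw [← exp_nat_mul]
      nth_rewrite 2 [← exp_pi_div_two_mul_I]
      rw [← exp_nat_mul, ← exp_add]
      congr 1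
      push_cast
      field_simp
      ring
    rwa [e, mul_assoc] at this
  set D := exp (Real.pi / 4 * I) * A with hD
  have hD0 : D ≠ 0 := mul_ne_zero (exp_ne_zero _) hA0
  have q0 := hquarter 0 (by norm_num)
  have q1 := hquarter 1 (by norm_num)
  have q2 := hquarter 2 (by norm_num)
  have q3 := hquarter 3 (by norm_num)
  rw [I_sq] at q2
  rw [I_pow_three] at q3
  simp at q0 q1 q2 q3
  exact hD0 (Complex.ext (by simpa using le_antisymm q1 q3) (by simpa using le_antisymm q0 q2))

/-- The zeros of `(z - 1) + (z + 1)Θ(z)` in the closed right half plane away from the origin are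
simple. -/
theorem IsRealSchur.deriv_ne_zero (h : IsRealSchur Θ) {z₀ : ℂ} (hre : 0 ≤ z₀.re) (hz₀ : z₀ ≠ 0)
    (h0 : (z₀ - 1) + (z₀ + 1) * Θ z₀ = 0) :
    deriv (fun z => (z - 1) + (z + 1) * Θ z) z₀ ≠ 0 := by
  intro hderiv
  set k : ℂ → ℂ := fun z => (z - 1) + (z + 1) * Θ z with hk
  have hka : ∀ z : ℂ, 0 ≤ z.re → AnalyticAt ℂ k z := fun z hz =>
    (analyticAt_id.sub analyticAt_const).add
      ((analyticAt_id.add analyticAt_const).mul (h.analyticAt z hz))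
  have hT : 1 + Θ z₀ ≠ 0 := fun hT => by
    have : (z₀ - 1) + (z₀ + 1) * Θ z₀ = -2 := by linear_combination (z₀ + 1) * hT
    rw [h0] at this
    norm_num at this
  have hden : (1 + Θ z₀) * z₀ ≠ 0 := mul_ne_zero hT hz₀
  have hdena : AnalyticAt ℂ (fun z => (1 + Θ z) * z) z₀ :=
    (analyticAt_const.add (h.analyticAt z₀ hre)).mul analyticAt_id
  set g : ℂ → ℂ := fun z => (1 - Θ z) / ((1 + Θ z) * z) - 1 with hg
  have hga : AnalyticAt ℂ g z₀ :=
    ((analyticAt_const.sub (h.analyticAt z₀ hre)).div hdena hden).sub analyticAt_const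
  have hgk : ∀ᶠ z in 𝓝 z₀, g z = -k z / ((1 + Θ z) * z) := by
    filter_upwards [hdena.continuousAt.eventually_ne hden] with z hz
    rw [hg, hk]
    simp only
    rw [div_sub_one hz]
    congr 1
    ring
  have hk0 : k z₀ = 0 := h0
  have hg0 : g z₀ = 0 := by rw [hgk.self_of_nhds, hk0]; simp
  have hgd : deriv g z₀ = 0 := by
    have hd := ((hka z₀ hre).differentiableAt.hasDerivAt.neg).div
      hdena.differentiableAt.hasDerivAt hden
    rw [EventuallyEq.deriv_eq hgk]
    refine hd.deriv.trans ?_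
    rw [hderiv, Pi.neg_apply, hk0]
    simp
  have hne : ¬∀ᶠ z in 𝓝 z₀, g z = 0 := by
    intro hev
    have hkev : k =ᶠ[𝓝 z₀] 0 := by
      filter_upwards [hev, hgk, hdena.continuousAt.eventually_ne hden] with z h1 h2 h3
      rw [h1, eq_comm, div_eq_zero_iff] at h2
      simpa [h3] using h2
    have hzero : Set.EqOn k 0 {z : ℂ | 0 ≤ z.re} :=
      AnalyticOnNhd.eqOn_zero_of_preconnected_of_eventuallyEq_zero (fun z hz => hka z hz)
        (convex_halfSpace_re_ge _).isPreconnected hre hkev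
    have hsmall : ∀ᶠ x : ℝ in atTop, ‖Θ x‖ < 1 / 4 := by
      have := h.tendsto_atTop.norm
      rw [norm_zero] at this
      exact this.eventually_lt_const (by norm_num)
    obtain ⟨x, hx, hx2⟩ := (hsmall.and (eventually_ge_atTop 2)).exists
    have hkx : (x : ℂ) - 1 + (x + 1) * Θ x = 0 :=
      hzero (show (0 : ℝ) ≤ (x : ℂ).re by simp; linarith)
    have e : ((x - 1 : ℝ) : ℂ) = -(((x + 1 : ℝ) : ℂ) * Θ x) := by
      push_cast
      linear_combination hkx
    have hn := congrArg norm e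
    rw [norm_neg, norm_mul, norm_real, norm_real, Real.norm_of_nonneg (by linarith),
      Real.norm_of_nonneg (by linarith)] at hn
    nlinarith
  have himg : ∀ z, 0 < z.re → z.im * (g z).im ≤ 0 := fun z hz => by
    simpa [hg] using h.im_mul_im_div_nonpos hz
  rcases lt_trichotomy z₀.im 0 with him | him | him
  · refine hga.deriv_ne_zero_of_im_nonpos hg0 hne (u := I) (c := -1) I_ne_zero (by simp) ?_ hgd
    filter_upwards [(isOpen_lt continuous_im continuous_const).mem_nhds him] with z hz hz'
    have hz : z.im < 0 := hz
    rw [I_mul_im, sub_re] at hz'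
    have := himg z (by linarith)
    simp only [neg_mul, one_mul, neg_im]
    nlinarith
  · have hre' : 0 < z₀.re := hre.lt_of_ne fun h' => hz₀ (Complex.ext h'.symm him)
    refine hga.deriv_ne_zero_of_im_nonpos hg0 hne (u := 1) (c := 1) one_ne_zero one_ne_zero ?_ hgd
    filter_upwards [(isOpen_lt continuous_const continuous_re).mem_nhds hre'] with z hz hz'
    rw [one_mul, sub_im, him, sub_zero] at hz'
    have := himg z hz
    rw [one_mul]
    exact nonpos_of_mul_nonpos_right this hz'
  · refine hga.deriv_ne_zero_of_im_nonpos hg0 hne (u := I) (c := 1) I_ne_zero one_ne_zero ?_ hgd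
    filter_upwards [(isOpen_lt continuous_const continuous_im).mem_nhds him] with z hz hz'
    have hz : 0 < z.im := hz
    rw [I_mul_im, sub_re] at hz'
    have := himg z (by linarith)
    rw [one_mul]
    exact nonpos_of_mul_nonpos_right this hz

end RealSchur

section Phi

theorem IsXi.isRealSchur_xiRatio {Z : ℂ → ℂ} {c : ℝ} {ξ : ℂ → ℂ} {a : ℝ} (h : IsXi Z c ξ)
    (hZ : ZetaProperties Z) (ha : 1 ≤ a) : IsRealSchur (xiRatio ξ a) where
  analyticAt z hz := by
    have ha0 : (a : ℂ) ≠ 0 := by exact_mod_cast (by linarith : a ≠ 0)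
    have h1 : Differentiable ℂ fun z : ℂ => (a : ℂ) ^ (-2 * z) := fun z =>
      DifferentiableAt.const_cpow (by fun_prop) (Or.inl ha0)
    have h2 : Differentiable ℂ fun z : ℂ => ξ (1 + z) :=
      h.differentiable.comp (by fun_prop : Differentiable ℂ fun z : ℂ => 1 + z)
    exact ((h1.mul h.differentiable).analyticAt z).div (h2.analyticAt z)
      (h.ne_zero hZ (by simpa using hz))
  norm_le_one _ hz := h.norm_xiRatio_le_one hZ ha hz
  conj := h.xiRatio_conj hZ ha
  tendsto_atTop := h.tendsto_xiRatio_atTop hZ ha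

variable {K : Type*} [Field K] [NumberField K] {ΛK : ℂ → ℂ} {a : ℝ}

theorem IsCompletedDedekindZeta.phiK_two_sub (hΛ : IsCompletedDedekindZeta K ΛK) (s : ℂ) :
    phiK ΛK a (2 - s) = phiK ΛK a s := by
  rw [phiK, phiK, hΛ.functional_equation (2 - s), hΛ.functional_equation (2 - s - 1),
    sub_sub_cancel, show 1 - (2 - s) = s - 1 by ring, show 1 - (2 - s - 1) = s by ring, add_comm]

theorem IsCompletedDedekindZeta.differentiableAt_phiK (hΛ : IsCompletedDedekindZeta K ΛK)
    (ha : 1 ≤ a) {s : ℂ} (h0 : s ≠ 0) (h1 : s ≠ 1) (h2 : s ≠ 2) :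
    DifferentiableAt ℂ (phiK ΛK a) s := by
  have ha0 : (a : ℂ) ≠ 0 := by exact_mod_cast (by linarith : a ≠ 0)
  have hopen : IsOpen ({0, 1}ᶜ : Set ℂ) := (Set.toFinite _).isClosed.isOpen_compl
  have hd : ∀ z : ℂ, z ≠ 0 → z ≠ 1 → DifferentiableAt ℂ ΛK z := fun z hz0 hz1 =>
    hΛ.differentiableOn.differentiableAt (hopen.mem_nhds (by simp [hz0, hz1]))
  have hs2 : s - 1 ≠ 1 := fun h => h2 (by linear_combination h)
  have hshift : DifferentiableAt ℂ (fun z : ℂ => ΛK (z - 1)) s :=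
    DifferentiableAt.comp (g := ΛK) (f := fun z : ℂ => z - 1) s (hd _ (sub_ne_zero.2 h1) hs2)
      (by fun_prop)
  have hpow1 : DifferentiableAt ℂ (fun z : ℂ => (a : ℂ) ^ z) s :=
    differentiableAt_id.const_cpow (Or.inl ha0)
  have hpow2 : DifferentiableAt ℂ (fun z : ℂ => (a : ℂ) ^ (2 - z)) s :=
    DifferentiableAt.const_cpow (by fun_prop) (Or.inl ha0)
  exact (hpow1.mul (hd s h0 h1)).add (hpow2.mul hshift)

theorem IsCompletedDedekindZeta.deriv_phiK_ne_zero_of_one_le_re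
    (hΛ : IsCompletedDedekindZeta K ΛK) (hZ : ZetaProperties (dedekindZetaSum K)) (ha : 1 ≤ a)
    {ρ : ℂ} (hre : 1 ≤ ρ.re) (h1 : ρ ≠ 1) (h2 : ρ ≠ 2) (hzero : phiK ΛK a ρ = 0) :
    deriv (phiK ΛK a) ρ ≠ 0 := by
  intro hderiv
  obtain ⟨ξ, hξ, hξΛ⟩ := hΛ.exists_isXi
  have h0 : ρ ≠ 0 := by rintro rfl; norm_num at hre
  have ha0 : (a : ℂ) ≠ 0 := by exact_mod_cast (by linarith : a ≠ 0)
  have hξρ : ξ ρ ≠ 0 := hξ.ne_zero hZ hre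
  set k : ℂ → ℂ := fun z => (z - 1) + (z + 1) * xiRatio ξ a z with hk
  set w : ℂ → ℂ := fun s => s * (s - 1) * (s - 2) / ((a : ℂ) ^ s * ξ s) with hw
  have hden : ∀ s : ℂ, ξ s ≠ 0 → (a : ℂ) ^ s * ξ s ≠ 0 := fun s hs =>
    mul_ne_zero (by simp [cpow_eq_zero_iff, ha0]) hs
  have hkw : ∀ᶠ s in 𝓝 ρ, k (s - 1) = phiK ΛK a s * w s := by
    filter_upwards [isOpen_ne.mem_nhds h0, isOpen_ne.mem_nhds h1, isOpen_ne.mem_nhds h2,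
      hξ.differentiable.continuous.continuousAt.eventually_ne hξρ] with s hs0 hs1 hs2 hs
    have hs0 : s ≠ 0 := hs0
    have hs1 : s - 1 ≠ 0 := sub_ne_zero.2 hs1
    have hs2' : s - 2 ≠ 0 := sub_ne_zero.2 hs2
    have e1 : ΛK s = ξ s / (s * (s - 1)) := by
      rw [hξΛ s hs0 (sub_ne_zero.1 hs1)]
      field_simp
    have e2 : ΛK (s - 1) = ξ (s - 1) / ((s - 1) * (s - 2)) := by
      rw [hξΛ (s - 1) hs1 (fun h => hs2' (by linear_combination h)),
        show s - 1 - 1 = s - 2 by ring]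
      field_simp
    have e3 : (a : ℂ) ^ (2 - s) = (a : ℂ) ^ s * (a : ℂ) ^ (-2 * (s - 1)) := by
      rw [← cpow_add _ _ ha0]
      ring_nf
    have hpow : (a : ℂ) ^ s ≠ 0 := by simp [cpow_eq_zero_iff, ha0]
    rw [hk, hw]
    simp only
    rw [phiK, xiRatio, e1, e2, e3, add_sub_cancel]
    field_simp
    ring
  have hwd : DifferentiableAt ℂ w ρ := by
    have hpow : DifferentiableAt ℂ (fun z : ℂ => (a : ℂ) ^ z) ρ :=
      differentiableAt_id.const_cpow (Or.inl ha0)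
    exact (by fun_prop : DifferentiableAt ℂ (fun s : ℂ => s * (s - 1) * (s - 2)) ρ).div
      (hpow.mul (hξ.differentiable ρ)) (hden ρ hξρ)
  have hk0 : k (ρ - 1) = 0 := by rw [hkw.self_of_nhds, hzero, zero_mul]
  have hkd : deriv k (ρ - 1) = 0 := by
    rw [← deriv_comp_sub_const, EventuallyEq.deriv_eq hkw]
    refine ((hΛ.differentiableAt_phiK ha h0 h1 h2).hasDerivAt.mul hwd.hasDerivAt).deriv.trans ?_
    rw [hderiv, hzero, zero_mul, zero_mul, add_zero]
  exact (hξ.isRealSchur_xiRatio hZ ha).deriv_ne_zero (by simpa using hre) (sub_ne_zero.2 h1) hk0 hkd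

end Phi

/-- For `K` imaginary quadratic of class number one and every `a ≥ 1`, every zero of
`φ_K(a,·)` away from `0, 1, 2` is simple. -/
theorem phiK_zeros_simple (K : Type*) [Field K] [NumberField K]
    (hdeg : Module.finrank ℚ K = 2)
    (himag : ∀ v : NumberField.InfinitePlace K, v.IsComplex)
    (hclass : NumberField.classNumber K = 1)
    (ΛK : ℂ → ℂ) (hΛ : IsCompletedDedekindZeta K ΛK)
    (a : ℝ) (ha : 1 ≤ a) (ρ : ℂ) (hρ : ρ ∉ ({0, 1, 2} : Set ℂ))
    (hzero : phiK ΛK a ρ = 0) : deriv (phiK ΛK a) ρ ≠ 0 := by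
  have hZ := zetaProperties_dedekindZetaSum K hdeg himag hclass
  simp only [Set.mem_insert_iff, Set.mem_singleton_iff, not_or] at hρ
  obtain ⟨h0, h1, h2⟩ := hρ
  rcases le_total 1 ρ.re with hre | hre
  · exact hΛ.deriv_phiK_ne_zero_of_one_le_re hZ ha hre h1 h2 hzero
  · have hsymm : deriv (phiK ΛK a) ρ = -deriv (phiK ΛK a) (2 - ρ) := by
      rw [← deriv_comp_const_sub]
      simp only [hΛ.phiK_two_sub]
    rw [hsymm, neg_ne_zero]
    exact hΛ.deriv_phiK_ne_zero_of_one_le_re hZ ha (by simp; linarith)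
      (fun h => h1 (by linear_combination -h)) (fun h => h0 (by linear_combination -h))
      (by rw [hΛ.phiK_two_sub, hzero])
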